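/- arXiv:1510.09148 — 3 statements merged into one kernel-verified Lean document; each statement's English description precedes it below -/
import Mathlib

section
/- Let α > −1/2 and τ ∈ ℝ. Then for every x > 0 the kernel Φ_{α,τ}(x) is a solution of the fourth-order ordinary differential equation x³ Φ⁗(x) + 6x² Φ‴(x) + x(7 + τ² − α² − x) Φ″(x) + (1 + τ² − α² − (5/2)x) Φ′(x) − ((ατ)²/x + 1/2) Φ(x) = 0. -/
/-- Modified Bessel function of the second kind (Macdonald function) of complex
order `ν` and real argument `x`: `K_ν(x) = ∫_0^∞ e^{−x cosh t} cosh(νt) dt`. -/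
noncomputable def besselK (ν : ℂ) (x : ℝ) : ℂ :=
  ∫ t in Set.Ioi (0 : ℝ), Complex.exp (-(x : ℂ) * Real.cosh t) * Complex.cosh (ν * t)

/-- Modified Bessel function of the first kind of complex order `ν` and real
argument `x`: `I_ν(x) = Σ_{k} (x/2)^{ν+2k} / (k! Γ(ν+k+1))`. -/
noncomputable def besselI (ν : ℂ) (x : ℝ) : ℂ :=
  ∑' k : ℕ, ((x : ℂ) / 2) ^ (ν + 2 * (k : ℂ)) / ((Nat.factorial k : ℂ) * Complex.Gamma (ν + (k : ℂ) + 1))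

/-- The kernel `Φ_{α,τ}(x) = (2√π / cosh(πτ)) · Re[K_{α+iτ}(√x) I_{α−iτ}(√x)]`. -/
noncomputable def PhiKer (α τ : ℝ) (x : ℝ) : ℝ :=
  (2 * Real.sqrt Real.pi / Real.cosh (Real.pi * τ)) *
    (besselK (α + τ * Complex.I) (Real.sqrt x) *
      besselI (α - τ * Complex.I) (Real.sqrt x)).re

open Set Filter Topology MeasureTheory

/-- If `f₀, …, f₄` are the successive images of `f₀` under the Euler operator `x d/dx` on the
positive half-line, the derivatives of `f₀` are the expected combinations of them. -/
lemma iteratedDeriv_of_euler {f₀ f₁ f₂ f₃ f₄ : ℝ → ℝ}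
    (h₀ : ∀ x, 0 < x → HasDerivAt f₀ (f₁ x / x) x)
    (h₁ : ∀ x, 0 < x → HasDerivAt f₁ (f₂ x / x) x)
    (h₂ : ∀ x, 0 < x → HasDerivAt f₂ (f₃ x / x) x)
    (h₃ : ∀ x, 0 < x → HasDerivAt f₃ (f₄ x / x) x) {x : ℝ} (hx : 0 < x) :
    deriv f₀ x = f₁ x / x ∧
    iteratedDeriv 2 f₀ x = (f₂ x - f₁ x) / x ^ 2 ∧
    iteratedDeriv 3 f₀ x = (f₃ x - 3 * f₂ x + 2 * f₁ x) / x ^ 3 ∧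
    iteratedDeriv 4 f₀ x = (f₄ x - 6 * f₃ x + 11 * f₂ x - 6 * f₁ x) / x ^ 4 := by
  have deriv_congr : ∀ {g h : ℝ → ℝ} {h' x : ℝ}, 0 < x → (∀ y, 0 < y → g y = h y) →
      HasDerivAt h h' x → deriv g x = h' := fun {g h h' x} hx hgh hh =>
    (hh.congr_of_eventuallyEq
      (by filter_upwards [Ioi_mem_nhds hx] with y hy using hgh y hy)).deriv
  have e1 : ∀ x, 0 < x → deriv f₀ x = f₁ x / x := fun x hx => (h₀ x hx).deriv
  have e2 : ∀ x, 0 < x → iteratedDeriv 2 f₀ x = (f₂ x - f₁ x) / x ^ 2 := by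
    intro x hx
    rw [iteratedDeriv_succ, iteratedDeriv_one]
    refine deriv_congr hx e1 (((h₁ x hx).div (hasDerivAt_id x) hx.ne').congr_deriv ?_)
    simp only [id]
    field_simp
  have e3 : ∀ x, 0 < x → iteratedDeriv 3 f₀ x = (f₃ x - 3 * f₂ x + 2 * f₁ x) / x ^ 3 := by
    intro x hx
    rw [iteratedDeriv_succ]
    refine deriv_congr hx e2 ((((h₂ x hx).sub (h₁ x hx)).div (hasDerivAt_pow 2 x)
      (pow_pos hx 2).ne').congr_deriv ?_)
    simp only [Pi.sub_apply]
    field_simp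
    push_cast
    ring
  refine ⟨e1 x hx, e2 x hx, e3 x hx, ?_⟩
  rw [iteratedDeriv_succ]
  refine deriv_congr hx e3 (((((h₃ x hx).sub ((h₂ x hx).const_mul 3)).add
    ((h₁ x hx).const_mul 2)).div (hasDerivAt_pow 3 x) (pow_pos hx 3).ne').congr_deriv ?_)
  simp only [Pi.sub_apply, Pi.add_apply]
  field_simp
  push_cast
  ring

/-! ### The modified Bessel function of the second kind -/

lemma exp_neg_mul_cosh_mul_exp_le {z c t : ℝ} (hz : 0 < z) (ht : 0 ≤ t) :
    Real.exp (-z * Real.cosh t) * Real.exp (c * t) ≤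
      Real.exp ((c + 1) ^ 2 / z) * Real.exp (-t) := by
  rw [← Real.exp_add, ← Real.exp_add, Real.exp_le_exp]
  have h1 : t ^ 2 / 4 ≤ Real.cosh t := by
    rw [Real.cosh_eq]
    nlinarith [Real.quadratic_le_exp_of_nonneg ht, Real.exp_pos (-t)]
  have h2 : (c + 1) * t ≤ z * (t ^ 2 / 4) + (c + 1) ^ 2 / z := by
    have : z * (t ^ 2 / 4) + (c + 1) ^ 2 / z - (c + 1) * t
        = (z * t / 2 - (c + 1)) ^ 2 / z := by
      field_simp
      ring
    have : 0 ≤ (z * t / 2 - (c + 1)) ^ 2 / z := by positivity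
    linarith
  nlinarith [mul_le_mul_of_nonneg_left h1 hz.le]

lemma norm_exp_neg_mul_cosh_mul_le {G : ℝ → ℂ} {c z₀ z t : ℝ}
    (hb : ∀ t, 0 ≤ t → ‖G t‖ ≤ Real.exp (c * t)) (hz₀ : 0 < z₀) (hz : z₀ ≤ z) (ht : 0 ≤ t) :
    ‖Complex.exp (-(z : ℂ) * Real.cosh t) * G t‖ ≤
      Real.exp ((c + 1) ^ 2 / z₀) * Real.exp (-t) := by
  rw [norm_mul, Complex.norm_exp]
  have : (-(z : ℂ) * Real.cosh t).re = -z * Real.cosh t := by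
    rw [← Complex.ofReal_neg, ← Complex.ofReal_mul, Complex.ofReal_re]
  rw [this]
  refine le_trans (mul_le_mul ?_ (hb t ht) (norm_nonneg _) (Real.exp_pos _).le)
    (exp_neg_mul_cosh_mul_exp_le hz₀ ht)
  rw [Real.exp_le_exp]
  nlinarith [Real.cosh_pos t]

lemma integrableOn_exp_neg_mul_cosh_mul {G : ℝ → ℂ} (hG : Continuous G) {c z : ℝ}
    (hb : ∀ t, 0 ≤ t → ‖G t‖ ≤ Real.exp (c * t)) (hz : 0 < z) :
    IntegrableOn (fun t : ℝ => Complex.exp (-(z : ℂ) * Real.cosh t) * G t) (Ioi 0) := by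
  refine Integrable.mono' ((integrableOn_exp_neg_Ioi 0).const_mul (Real.exp ((c + 1) ^ 2 / z)))
    (Continuous.aestronglyMeasurable (by fun_prop)) ?_
  filter_upwards [ae_restrict_mem measurableSet_Ioi] with t ht
  exact norm_exp_neg_mul_cosh_mul_le hb hz le_rfl (le_of_lt ht)

lemma norm_cosh_mul_le {G : ℝ → ℂ} {c : ℝ} (hb : ∀ t, 0 ≤ t → ‖G t‖ ≤ Real.exp (c * t)) :
    ∀ t, 0 ≤ t → ‖(Real.cosh t : ℂ) * G t‖ ≤ Real.exp ((c + 1) * t) := by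
  intro t ht
  rw [norm_mul, Complex.norm_real, Real.norm_of_nonneg (Real.cosh_pos t).le,
    show (c + 1) * t = t + c * t by ring, Real.exp_add]
  refine mul_le_mul ?_ (hb t ht) (norm_nonneg _) (Real.exp_pos _).le
  rw [Real.cosh_eq]
  have : Real.exp (-t) ≤ Real.exp t := Real.exp_le_exp.2 (by linarith)
  linarith

lemma hasDerivAt_integral_exp_neg_mul_cosh_mul {G : ℝ → ℂ} (hG : Continuous G) {c z : ℝ}
    (hb : ∀ t, 0 ≤ t → ‖G t‖ ≤ Real.exp (c * t)) (hz : 0 < z) :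
    HasDerivAt (fun z : ℝ => ∫ t in Ioi (0 : ℝ), Complex.exp (-(z : ℂ) * Real.cosh t) * G t)
      (-∫ t in Ioi (0 : ℝ), Complex.exp (-(z : ℂ) * Real.cosh t) * (Real.cosh t * G t)) z := by
  have hb' := norm_cosh_mul_le hb
  rw [← integral_neg]
  refine (hasDerivAt_integral_of_dominated_loc_of_deriv_le
    (F := fun (z : ℝ) t => Complex.exp (-(z : ℂ) * Real.cosh t) * G t)
    (bound := fun t => Real.exp ((c + 1 + 1) ^ 2 / (z / 2)) * Real.exp (-t))
    (Ioi_mem_nhds (show z / 2 < z by linarith)) (Eventually.of_forall fun y =>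
      Continuous.aestronglyMeasurable (by fun_prop))
    (integrableOn_exp_neg_mul_cosh_mul hG hb hz)
    (F' := fun z t => -(Complex.exp (-(z : ℂ) * Real.cosh t) * (Real.cosh t * G t)))
    (Continuous.aestronglyMeasurable (by fun_prop)) ?_
    ((integrableOn_exp_neg_Ioi 0).const_mul _) ?_).2
  · filter_upwards [ae_restrict_mem measurableSet_Ioi] with t ht y hy
    rw [norm_neg]
    exact norm_exp_neg_mul_cosh_mul_le hb' (by linarith) (le_of_lt hy) (le_of_lt ht)
  · refine Eventually.of_forall fun t y _ => ?_
    have h := (((hasDerivAt_id (y : ℂ)).neg.mul_const (Real.cosh t : ℂ)).cexp.mul_const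
      (G t)).comp_ofReal
    refine h.congr_deriv ?_
    simp only [Pi.neg_apply, id]
    ring

lemma norm_cexp_mul_ofReal_le (ν : ℂ) {t : ℝ} (ht : 0 ≤ t) :
    ‖Complex.exp (ν * t)‖ ≤ Real.exp (‖ν‖ * t) := by
  refine (Complex.norm_exp_le_exp_norm _).trans_eq ?_
  rw [norm_mul, Complex.norm_real, Real.norm_of_nonneg ht]

lemma norm_ccosh_mul_ofReal_le (ν : ℂ) (t : ℝ) (ht : 0 ≤ t) :
    ‖Complex.cosh (ν * t)‖ ≤ Real.exp (‖ν‖ * t) := by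
  have h1 := norm_cexp_mul_ofReal_le ν ht
  have h2 := norm_cexp_mul_ofReal_le (-ν) ht
  rw [norm_neg, neg_mul] at h2
  rw [Complex.cosh, norm_div, Complex.norm_two]
  linarith [norm_add_le (Complex.exp (ν * t)) (Complex.exp (-(ν * t)))]

lemma norm_csinh_mul_ofReal_le (ν : ℂ) (t : ℝ) (ht : 0 ≤ t) :
    ‖Complex.sinh (ν * t)‖ ≤ Real.exp (‖ν‖ * t) := by
  have h1 := norm_cexp_mul_ofReal_le ν ht
  have h2 := norm_cexp_mul_ofReal_le (-ν) ht
  rw [norm_neg, neg_mul] at h2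
  rw [Complex.sinh, norm_div, Complex.norm_two]
  linarith [norm_sub_le (Complex.exp (ν * t)) (Complex.exp (-(ν * t)))]

/-- The derivative of `besselK ν`. -/
noncomputable def besselKDeriv (ν : ℂ) (z : ℝ) : ℂ :=
  -∫ t in Ioi (0 : ℝ),
    Complex.exp (-(z : ℂ) * Real.cosh t) * (Real.cosh t * Complex.cosh (ν * t))

lemma hasDerivAt_besselK (ν : ℂ) {z : ℝ} (hz : 0 < z) :
    HasDerivAt (besselK ν) (besselKDeriv ν z) z :=
  hasDerivAt_integral_exp_neg_mul_cosh_mul (by fun_prop) (norm_ccosh_mul_ofReal_le ν) hz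

lemma tendsto_exp_neg_mul_cosh_mul {G : ℝ → ℂ} {c z : ℝ}
    (hb : ∀ t, 0 ≤ t → ‖G t‖ ≤ Real.exp (c * t)) (hz : 0 < z) :
    Tendsto (fun t : ℝ => Complex.exp (-(z : ℂ) * Real.cosh t) * G t) atTop (𝓝 0) := by
  refine squeeze_zero_norm' (a := fun t => Real.exp ((c + 1) ^ 2 / z) * Real.exp (-t)) ?_ ?_
  · filter_upwards [eventually_ge_atTop 0] with t ht
    exact norm_exp_neg_mul_cosh_mul_le hb hz le_rfl ht
  · simpa using Real.tendsto_exp_neg_atTop_nhds_zero.const_mul (Real.exp ((c + 1) ^ 2 / z))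

/-- The modified Bessel equation for `besselK ν`. -/
lemma hasDerivAt_besselKDeriv (ν : ℂ) {z : ℝ} (hz : 0 < z) :
    HasDerivAt (besselKDeriv ν)
      (((z ^ 2 + ν ^ 2) * besselK ν z - z * besselKDeriv ν z) / z ^ 2) z := by
  have b0 := norm_ccosh_mul_ofReal_le ν
  have b1 := norm_cosh_mul_le b0
  have b2 := norm_cosh_mul_le b1
  have i0 := integrableOn_exp_neg_mul_cosh_mul (by fun_prop) b0 hz
  have i1 := integrableOn_exp_neg_mul_cosh_mul (by fun_prop) b1 hz
  have i2 := integrableOn_exp_neg_mul_cosh_mul (by fun_prop) b2 hz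
  have i21 : Integrable (fun t : ℝ =>
      (z : ℂ) ^ 2 * (Complex.exp (-(z : ℂ) * Real.cosh t) *
        (Real.cosh t * (Real.cosh t * Complex.cosh (ν * t)))) -
      z * (Complex.exp (-(z : ℂ) * Real.cosh t) * (Real.cosh t * Complex.cosh (ν * t))))
      (volume.restrict (Ioi 0)) := (i2.const_mul _).sub (i1.const_mul _)
  have hsinh : ∀ t : ℝ, 0 ≤ t → ‖(Real.sinh t : ℂ) * Complex.cosh (ν * t)‖ ≤
      Real.exp ((‖ν‖ + 1) * t) := fun t ht => by
    refine le_trans ?_ (b1 t ht)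
    rw [norm_mul, norm_mul, Complex.norm_real, Complex.norm_real,
      Real.norm_of_nonneg (Real.cosh_pos t).le, Real.norm_of_nonneg (Real.sinh_nonneg_iff.2 ht)]
    exact mul_le_mul_of_nonneg_right (Real.sinh_lt_cosh t).le (norm_nonneg _)
  have key := integral_Ioi_of_hasDerivAt_of_tendsto' (a := (0 : ℝ)) (m := (0 : ℂ))
    (f := fun t : ℝ => -z * (Complex.exp (-(z : ℂ) * Real.cosh t) *
        (Real.sinh t * Complex.cosh (ν * t))) -
      ν * (Complex.exp (-(z : ℂ) * Real.cosh t) * Complex.sinh (ν * t)))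
    (f' := fun t : ℝ =>
      (z : ℂ) ^ 2 * (Complex.exp (-(z : ℂ) * Real.cosh t) *
        (Real.cosh t * (Real.cosh t * Complex.cosh (ν * t)))) -
      z * (Complex.exp (-(z : ℂ) * Real.cosh t) * (Real.cosh t * Complex.cosh (ν * t))) -
      (z ^ 2 + ν ^ 2) * (Complex.exp (-(z : ℂ) * Real.cosh t) * Complex.cosh (ν * t)))
    ?_ (by exact i21.sub (i0.const_mul _)) ?_
  · rw [integral_sub i21 (i0.const_mul _),
      integral_sub (i2.const_mul _) (i1.const_mul _), integral_const_mul, integral_const_mul,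
      integral_const_mul] at key
    have hd := (hasDerivAt_integral_exp_neg_mul_cosh_mul
      (G := fun t : ℝ => (Real.cosh t : ℂ) * Complex.cosh (ν * t)) (by fun_prop) b1 hz).neg
    refine hd.congr_deriv ?_
    have hz' : (z : ℂ) ≠ 0 := by exact_mod_cast hz.ne'
    rw [eq_div_iff (pow_ne_zero 2 hz'), besselK, besselKDeriv]
    simp only [Real.sinh_zero, Complex.ofReal_zero, mul_zero, Complex.sinh_zero, zero_mul,
      sub_zero] at key
    linear_combination key
  · intro t _
    have hc : HasDerivAt (fun t : ℝ => (Real.cosh t : ℂ)) (Real.sinh t) t :=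
      (Real.hasDerivAt_cosh t).ofReal_comp
    have hs : HasDerivAt (fun t : ℝ => (Real.sinh t : ℂ)) (Real.cosh t) t :=
      (Real.hasDerivAt_sinh t).ofReal_comp
    have hl : HasDerivAt (fun t : ℝ => ν * (t : ℂ)) ν t := by
      simpa using ((hasDerivAt_id (t : ℂ)).const_mul ν).comp_ofReal
    have he := (hc.const_mul (-(z : ℂ))).cexp
    have hcc : HasDerivAt (fun t : ℝ => Complex.cosh (ν * t)) (Complex.sinh (ν * t) * ν) t :=
      (Complex.hasDerivAt_cosh _).comp t hl
    have hss : HasDerivAt (fun t : ℝ => Complex.sinh (ν * t)) (Complex.cosh (ν * t) * ν) t :=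
      (Complex.hasDerivAt_sinh _).comp t hl
    refine (((he.mul (hs.mul hcc)).const_mul (-(z : ℂ))).sub
      ((he.mul hss).const_mul ν)).congr_deriv ?_
    have hsq : (Real.cosh t : ℂ) ^ 2 = (Real.sinh t : ℂ) ^ 2 + 1 := by
      exact_mod_cast Real.cosh_sq t
    simp only [Pi.mul_apply]
    linear_combination
      -(z : ℂ) ^ 2 * Complex.exp (-(z : ℂ) * Real.cosh t) * Complex.cosh (ν * t) * hsq
  · simpa using ((tendsto_exp_neg_mul_cosh_mul hsinh hz).const_mul (-(z : ℂ))).sub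
      ((tendsto_exp_neg_mul_cosh_mul (norm_csinh_mul_ofReal_le ν) hz).const_mul ν)

lemma hasDerivAt_besselK_sqrt (ν : ℂ) {x : ℝ} (hx : 0 < x) :
    HasDerivAt (fun x => besselK ν (√x)) (√x * besselKDeriv ν (√x) / 2 / x) x := by
  have hs : 0 < √x := Real.sqrt_pos.2 hx
  have hs' : (√x : ℂ) ≠ 0 := by exact_mod_cast hs.ne'
  have hsq : (x : ℂ) = (√x : ℂ) ^ 2 := by exact_mod_cast (Real.sq_sqrt hx.le).symm
  refine ((hasDerivAt_besselK ν hs).scomp x (Real.hasDerivAt_sqrt hx.ne')).congr_deriv ?_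
  rw [Complex.real_smul, hsq]
  push_cast
  field_simp

lemma hasDerivAt_sqrt_mul_besselKDeriv_sqrt (ν : ℂ) {x : ℝ} (hx : 0 < x) :
    HasDerivAt (fun x => (√x : ℂ) * besselKDeriv ν (√x) / 2)
      ((x + ν ^ 2) / 4 * besselK ν (√x) / x) x := by
  have hs : 0 < √x := Real.sqrt_pos.2 hx
  have hs' : (√x : ℂ) ≠ 0 := by exact_mod_cast hs.ne'
  have hsq : (x : ℂ) = (√x : ℂ) ^ 2 := by exact_mod_cast (Real.sq_sqrt hx.le).symm
  have hd := Real.hasDerivAt_sqrt hx.ne'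
  refine ((hd.ofReal_comp.mul
    ((hasDerivAt_besselKDeriv ν hs).scomp x hd)).div_const 2).congr_deriv ?_
  simp only [Complex.real_smul, Function.comp_apply]
  rw [hsq]
  push_cast
  field_simp
  ring

/-! ### The modified Bessel function of the first kind -/

/-- Power series coefficients of `(z / 2) ^ (-ν) * besselI ν z` in the variable `z ^ 2 / 4`. -/
noncomputable def besselICoeff (ν : ℂ) (k : ℕ) : ℂ :=
  1 / ((k.factorial : ℂ) * Complex.Gamma (ν + k + 1))

lemma besselICoeff_succ (ν : ℂ) (k : ℕ) :
    (k + 1) * besselICoeff ν (k + 1) = besselICoeff (ν + 1) k := by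
  have : (k + 1 : ℂ) ≠ 0 := by exact_mod_cast k.succ_ne_zero
  rw [besselICoeff, besselICoeff, Nat.factorial_succ]
  push_cast
  rw [show ν + (k + 1 : ℂ) + 1 = ν + 1 + k + 1 by ring, mul_assoc, one_div, one_div, mul_inv,
    mul_inv_cancel_left₀ this]

lemma besselICoeff_add_one (ν : ℂ) (k : ℕ) :
    (ν + k + 1) * besselICoeff (ν + 1) k = besselICoeff ν k := by
  have h := Complex.one_div_Gamma_eq_self_mul_one_div_Gamma_add_one (ν + k + 1)
  rw [besselICoeff, besselICoeff, one_div, one_div, mul_inv, mul_inv, h,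
    show ν + k + 1 + 1 = ν + 1 + k + 1 by ring]
  ring

lemma summable_norm_besselICoeff (ν : ℂ) (r : ℝ) :
    Summable fun k => ‖besselICoeff ν k‖ * r ^ k := by
  refine summable_of_ratio_norm_eventually_le (r := 1 / 2) (by norm_num) ?_
  filter_upwards [eventually_ge_atTop ⌈‖ν‖ + 2 * |r| + 1⌉₊] with k hk
  have hk' : ‖ν‖ + 2 * |r| + 1 ≤ k := (Nat.le_ceil _).trans (by exact_mod_cast hk)
  have hlow : 2 * |r| ≤ ‖ν + k + 1‖ := by
    have h1 : ‖(k + 1 : ℂ)‖ = k + 1 := by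
      have := Complex.norm_natCast (k + 1)
      push_cast at this
      exact this
    have h2 := norm_sub_norm_le (k + 1 : ℂ) (-ν)
    rw [norm_neg, h1, show (k + 1 : ℂ) - -ν = ν + k + 1 by ring] at h2
    linarith
  have hmul : ‖besselICoeff ν k‖ = ‖ν + k + 1‖ * ((k + 1) * ‖besselICoeff ν (k + 1)‖) := by
    rw [← besselICoeff_add_one, ← besselICoeff_succ, norm_mul, norm_mul]
    have := Complex.norm_natCast (k + 1)
    push_cast at this
    rw [this]
  have hB := norm_nonneg (besselICoeff ν (k + 1))
  have hle : 2 * |r| * ‖besselICoeff ν (k + 1)‖ ≤ ‖besselICoeff ν k‖ := by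
    rw [hmul]
    refine mul_le_mul hlow ?_ hB (norm_nonneg _)
    have : (0 : ℝ) ≤ k := k.cast_nonneg
    nlinarith
  rw [norm_mul, norm_mul, norm_norm, norm_norm, norm_pow, norm_pow, Real.norm_eq_abs, pow_succ]
  nlinarith [mul_le_mul_of_nonneg_right hle (pow_nonneg (abs_nonneg r) k)]

lemma summable_besselICoeff (ν : ℂ) (y : ℝ) :
    Summable fun k => besselICoeff ν k * (y : ℂ) ^ k := by
  refine Summable.of_norm ((summable_norm_besselICoeff ν |y|).congr fun k => ?_)
  rw [norm_mul, norm_pow, Complex.norm_real, Real.norm_eq_abs]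

/-- The entire part `(z / 2) ^ (-ν) * besselI ν z` in the variable `y = z ^ 2 / 4`. -/
noncomputable def besselISeries (ν : ℂ) (y : ℝ) : ℂ :=
  ∑' k, besselICoeff ν k * (y : ℂ) ^ k

lemma hasDerivAt_besselISeries (ν : ℂ) (y : ℝ) :
    HasDerivAt (besselISeries ν) (besselISeries (ν + 1) y) y := by
  have hsucc : ∀ (k : ℕ) (y : ℝ), besselICoeff ν (k + 1) *
      (((k + 1 : ℕ) : ℂ) * (y : ℂ) ^ (k + 1 - 1)) = besselICoeff (ν + 1) k * (y : ℂ) ^ k := by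
    intro k y
    rw [← besselICoeff_succ]
    push_cast
    ring
  have hsum : Summable fun k : ℕ => besselICoeff ν k * ((k : ℂ) * (y : ℂ) ^ (k - 1)) := by
    rw [← summable_nat_add_iff 1]
    exact (summable_besselICoeff (ν + 1) y).congr fun k => (hsucc k y).symm
  have hd := hasDerivAt_tsum_of_isPreconnected
    (g := fun (k : ℕ) (y : ℝ) => besselICoeff ν k * (y : ℂ) ^ k)
    (g' := fun (k : ℕ) (y : ℝ) => besselICoeff ν k * ((k : ℂ) * (y : ℂ) ^ (k - 1)))
    (u := fun k : ℕ => ‖besselICoeff ν k‖ * (k * (|y| + 1) ^ (k - 1)))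
    (t := Metric.ball 0 (|y| + 1)) (y₀ := y) (y := y) ?_ Metric.isOpen_ball
    (convex_ball _ _).isPreconnected ?_ ?_ (by simp) (summable_besselICoeff ν y) (by simp)
  · refine hd.congr_deriv ?_
    rw [hsum.tsum_eq_zero_add, besselISeries]
    simp only [hsucc]
    simp
  · rw [← summable_nat_add_iff 1]
    refine (summable_norm_besselICoeff (ν + 1) (|y| + 1)).congr fun k => ?_
    rw [← besselICoeff_succ, norm_mul]
    have := Complex.norm_natCast (k + 1)
    push_cast at this ⊢
    rw [this]
    ring
  · intro k w _
    exact ((hasDerivAt_pow k (w : ℂ)).comp_ofReal).const_mul _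
  · intro k w hw
    have hw' : |w| ≤ |y| + 1 := by simpa using (mem_ball_zero_iff.1 hw).le
    rw [norm_mul, norm_mul, norm_pow, Complex.norm_natCast, Complex.norm_real, Real.norm_eq_abs]
    gcongr

lemma besselISeries_eq (ν : ℂ) (y : ℝ) :
    besselISeries ν y =
      (ν + 1) * besselISeries (ν + 1) y + y * besselISeries (ν + 1 + 1) y := by
  have h : ∀ k : ℕ, besselICoeff ν k * (y : ℂ) ^ k =
      (ν + 1) * (besselICoeff (ν + 1) k * (y : ℂ) ^ k) +
        k * besselICoeff (ν + 1) k * (y : ℂ) ^ k := by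
    intro k
    rw [← besselICoeff_add_one]
    ring
  have hs : ∀ k : ℕ, (((k + 1 : ℕ) : ℂ)) * besselICoeff (ν + 1) (k + 1) * (y : ℂ) ^ (k + 1) =
      y * (besselICoeff (ν + 1 + 1) k * (y : ℂ) ^ k) := by
    intro k
    rw [← besselICoeff_succ (ν + 1)]
    push_cast
    ring
  have hsum : Summable fun k : ℕ => (k : ℂ) * besselICoeff (ν + 1) k * (y : ℂ) ^ k := by
    rw [← summable_nat_add_iff 1]
    exact ((summable_besselICoeff (ν + 1 + 1) y).mul_left (y : ℂ)).congr fun k => (hs k).symm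
  simp only [besselISeries]
  rw [tsum_congr h, ((summable_besselICoeff (ν + 1) y).mul_left _).tsum_add hsum, tsum_mul_left,
    hsum.tsum_eq_zero_add, tsum_congr hs, tsum_mul_left]
  simp

lemma besselI_sqrt (ν : ℂ) {x : ℝ} (hx : 0 < x) :
    besselI ν (√x) = Complex.exp (ν / 2 * Real.log (x / 4)) * besselISeries ν (x / 4) := by
  have hs : 0 < √x / 2 := by positivity
  have hs' : ((√x : ℂ) / 2) ≠ 0 := by exact_mod_cast hs.ne'
  have hsq : (√x / 2) ^ 2 = x / 4 := by
    rw [div_pow, Real.sq_sqrt hx.le]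
    norm_num
  rw [besselI, besselISeries, ← tsum_mul_left]
  refine tsum_congr fun k => ?_
  have h1 : ((√x : ℂ) / 2) ^ (2 * (k : ℂ)) = ((x / 4 : ℝ) : ℂ) ^ k := by
    rw [show 2 * (k : ℂ) = ((2 * k : ℕ) : ℂ) by push_cast; ring, Complex.cpow_natCast, pow_mul,
      ← hsq]
    push_cast
    ring
  have h2 : ((√x : ℂ) / 2) ^ ν = Complex.exp (ν / 2 * Real.log (x / 4)) := by
    rw [Complex.cpow_def_of_ne_zero hs', ← hsq, Real.log_pow,
      show ((√x : ℂ) / 2) = ((√x / 2 : ℝ) : ℂ) by push_cast; ring, ← Complex.ofReal_log hs.le]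
    push_cast
    ring_nf
  rw [Complex.cpow_add _ _ hs', h1, h2, besselICoeff]
  ring

/-- The Euler derivative of `x ↦ besselI ν (√x)`. -/
noncomputable def besselISqrtEuler (ν : ℂ) (x : ℝ) : ℂ :=
  Complex.exp (ν / 2 * Real.log (x / 4)) *
    (ν / 2 * besselISeries ν (x / 4) + (x / 4 : ℝ) * besselISeries (ν + 1) (x / 4))

lemma hasDerivAt_cexp_mul_log_div (ν : ℂ) {x : ℝ} (hx : 0 < x) :
    HasDerivAt (fun x : ℝ => Complex.exp (ν / 2 * Real.log (x / 4)))
      (Complex.exp (ν / 2 * Real.log (x / 4)) * (ν / 2) / x) x := by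
  have hx' : (x : ℂ) ≠ 0 := by exact_mod_cast hx.ne'
  have hl := (((hasDerivAt_id x).div_const 4).log (by simp [hx.ne'])).ofReal_comp
  refine ((hl.const_mul (ν / 2)).cexp).congr_deriv ?_
  simp only [id]
  push_cast
  field_simp

lemma hasDerivAt_besselISeries_div_four (ν : ℂ) (x : ℝ) :
    HasDerivAt (fun x : ℝ => besselISeries ν (x / 4)) (besselISeries (ν + 1) (x / 4) / 4) x := by
  refine ((hasDerivAt_besselISeries ν (x / 4)).scomp x
    ((hasDerivAt_id x).div_const 4)).congr_deriv ?_
  rw [Complex.real_smul]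
  push_cast
  ring

lemma hasDerivAt_besselI_sqrt (ν : ℂ) {x : ℝ} (hx : 0 < x) :
    HasDerivAt (fun x => besselI ν (√x)) (besselISqrtEuler ν x / x) x := by
  have hx' : (x : ℂ) ≠ 0 := by exact_mod_cast hx.ne'
  have hd := ((hasDerivAt_cexp_mul_log_div ν hx).mul
    (hasDerivAt_besselISeries_div_four ν x)).congr_deriv
      (g' := besselISqrtEuler ν x / x) (by
        rw [besselISqrtEuler]
        push_cast
        field_simp)
  refine hd.congr_of_eventuallyEq ?_
  filter_upwards [Ioi_mem_nhds hx] with y hy using besselI_sqrt ν hy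

lemma hasDerivAt_besselISqrtEuler (ν : ℂ) {x : ℝ} (hx : 0 < x) :
    HasDerivAt (besselISqrtEuler ν) ((x + ν ^ 2) / 4 * besselI ν (√x) / x) x := by
  have hx' : (x : ℂ) ≠ 0 := by exact_mod_cast hx.ne'
  have hl := ((hasDerivAt_id x).div_const 4).ofReal_comp
  refine ((hasDerivAt_cexp_mul_log_div ν hx).mul
    (((hasDerivAt_besselISeries_div_four ν x).const_mul (ν / 2)).add
      (hl.mul (hasDerivAt_besselISeries_div_four (ν + 1) x)))).congr_deriv ?_
  rw [besselI_sqrt ν hx]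
  have h := besselISeries_eq ν (x / 4)
  simp only [id, Pi.add_apply, Pi.mul_apply]
  push_cast at h ⊢
  field_simp
  linear_combination (-16 * (x : ℂ)) * h

/-! ### Products of solutions -/

/-- If `θ = x d/dx`, `θ² u = (x + μ²) / 4 * u` and `θ² v = (x + ν²) / 4 * v` on the positive
half-line, then `w = u * v` satisfies
`θ⁴ w = (x + (μ² + ν²) / 2) θ² w + 3 x / 2 * θ w + (x / 2 - ((μ² - ν²) / 4)²) w`. -/
lemma exists_euler_mul {μ ν : ℂ} {u u₁ v v₁ : ℝ → ℂ}
    (hu : ∀ x, 0 < x → HasDerivAt u (u₁ x / x) x)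
    (hu₁ : ∀ x, 0 < x → HasDerivAt u₁ ((x + μ ^ 2) / 4 * u x / x) x)
    (hv : ∀ x, 0 < x → HasDerivAt v (v₁ x / x) x)
    (hv₁ : ∀ x, 0 < x → HasDerivAt v₁ ((x + ν ^ 2) / 4 * v x / x) x) :
    ∃ w₁ w₂ w₃ w₄ : ℝ → ℂ,
      (∀ x, 0 < x → HasDerivAt (fun x => u x * v x) (w₁ x / x) x) ∧
      (∀ x, 0 < x → HasDerivAt w₁ (w₂ x / x) x) ∧
      (∀ x, 0 < x → HasDerivAt w₂ (w₃ x / x) x) ∧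
      (∀ x, 0 < x → HasDerivAt w₃ (w₄ x / x) x) ∧
      ∀ x, w₄ x = (x + (μ ^ 2 + ν ^ 2) / 2) * w₂ x + 3 / 2 * x * w₁ x +
        (x / 2 - ((μ ^ 2 - ν ^ 2) / 4) ^ 2) * (u x * v x) := by
  let w₁ : ℝ → ℂ := fun x => u₁ x * v x + u x * v₁ x
  let w₂ : ℝ → ℂ := fun x => (x + (μ ^ 2 + ν ^ 2) / 2) / 2 * (u x * v x) + 2 * (u₁ x * v₁ x)
  let w₃ : ℝ → ℂ := fun x => (x + (μ ^ 2 + ν ^ 2) / 2) * w₁ x + x / 2 * (u x * v x) +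
    (μ ^ 2 - ν ^ 2) / 4 * (u x * v₁ x - u₁ x * v x)
  have hid : ∀ x : ℝ, HasDerivAt (fun x : ℝ => (x : ℂ)) 1 x := fun x =>
    (hasDerivAt_id (x : ℂ)).comp_ofReal
  have h0 : ∀ x, 0 < x → HasDerivAt (fun x => u x * v x) (w₁ x / x) x := fun x hx =>
    ((hu x hx).mul (hv x hx)).congr_deriv (by simp only [w₁]; ring)
  have h1 : ∀ x, 0 < x → HasDerivAt w₁ (w₂ x / x) x := fun x hx =>
    (((hu₁ x hx).mul (hv x hx)).add ((hu x hx).mul (hv₁ x hx))).congr_deriv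
      (by simp only [w₂]; ring)
  refine ⟨w₁, w₂, w₃, _, h0, h1, fun x hx => ?_, fun x hx => ?_, fun x => rfl⟩
  · have hx' : (x : ℂ) ≠ 0 := by exact_mod_cast hx.ne'
    refine ((((((hid x).add_const _).div_const 2).mul (h0 x hx)).add
      (((hu₁ x hx).mul (hv₁ x hx)).const_mul 2))).congr_deriv ?_
    simp only [w₃, w₁]
    field_simp
    ring
  · have hx' : (x : ℂ) ≠ 0 := by exact_mod_cast hx.ne'
    refine (((((hid x).add_const _).mul (h1 x hx)).add (((hid x).div_const 2).mul (h0 x hx))).add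
      ((((hu x hx).mul (hv₁ x hx)).sub ((hu₁ x hx).mul (hv x hx))).const_mul _)).congr_deriv ?_
    simp only [w₂, w₁]
    field_simp
    ring

/-- Lemma 1: for `α > −1/2` the kernel `Φ_{α,τ}` solves the
fourth-order ODE
`x³Φ⁗ + 6x²Φ‴ + x(7+τ²−α²−x)Φ″ + (1+τ²−α²−(5/2)x)Φ′ − ((ατ)²/x + 1/2)Φ = 0`
for every `x > 0`. -/
theorem statement0 (α τ : ℝ) (hα : α > -1/2) :
    ∀ x : ℝ, 0 < x →
      x ^ 3 * iteratedDeriv 4 (PhiKer α τ) x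
        + 6 * x ^ 2 * iteratedDeriv 3 (PhiKer α τ) x
        + x * (7 + τ ^ 2 - α ^ 2 - x) * iteratedDeriv 2 (PhiKer α τ) x
        + (1 + τ ^ 2 - α ^ 2 - 5 / 2 * x) * deriv (PhiKer α τ) x
        - ((α * τ) ^ 2 / x + 1 / 2) * PhiKer α τ x = 0 := by
  intro x hx
  set c : ℝ := 2 * Real.sqrt Real.pi / Real.cosh (Real.pi * τ)
  set μ : ℂ := α + τ * Complex.I with hμ
  set ν : ℂ := α - τ * Complex.I with hν
  obtain ⟨w₁, w₂, w₃, w₄, h0, h1, h2, h3, h4⟩ := exists_euler_mul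
    (fun _ => hasDerivAt_besselK_sqrt μ) (fun _ => hasDerivAt_sqrt_mul_besselKDeriv_sqrt μ)
    (fun _ => hasDerivAt_besselI_sqrt ν) (fun _ => hasDerivAt_besselISqrtEuler ν)
  have re_deriv : ∀ {f : ℝ → ℂ} {g : ℂ} {y : ℝ}, HasDerivAt f (g / y) y →
      HasDerivAt (fun y => c * (f y).re) (c * g.re / y) y := by
    intro f g y h
    refine ((Complex.reCLM.hasFDerivAt.comp_hasDerivAt y h).const_mul c).congr_deriv ?_
    rw [Complex.reCLM_apply, Complex.div_ofReal_re, mul_div_assoc]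
  obtain ⟨d1, d2, d3, d4⟩ := iteratedDeriv_of_euler (fun y hy => re_deriv (h0 y hy))
    (fun y hy => re_deriv (h1 y hy)) (fun y hy => re_deriv (h2 y hy))
    (fun y hy => re_deriv (h3 y hy)) hx
  have hPhi : PhiKer α τ = fun y => c * (besselK μ (√y) * besselI ν (√y)).re := rfl
  have hsum : (μ ^ 2 + ν ^ 2) / 2 = ((α ^ 2 - τ ^ 2 : ℝ) : ℂ) := by
    rw [hμ, hν]
    push_cast
    linear_combination (τ : ℂ) ^ 2 * Complex.I_sq
  have hdiff : ((μ ^ 2 - ν ^ 2) / 4) ^ 2 = ((-(α * τ) ^ 2 : ℝ) : ℂ) := by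
    rw [hμ, hν]
    push_cast
    linear_combination (α : ℂ) ^ 2 * (τ : ℂ) ^ 2 * Complex.I_sq
  have split : ∀ a b d : ℂ, (((x : ℂ) + (μ ^ 2 + ν ^ 2) / 2) * a + 3 / 2 * x * b +
      (x / 2 - ((μ ^ 2 - ν ^ 2) / 4) ^ 2) * d).re =
      (x + α ^ 2 - τ ^ 2) * a.re + 3 / 2 * x * b.re + (x / 2 + (α * τ) ^ 2) * d.re := by
    intro a b d
    rw [hsum, hdiff, show ((x : ℂ) + ((α ^ 2 - τ ^ 2 : ℝ) : ℂ)) * a + 3 / 2 * x * b +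
      (x / 2 - ((-(α * τ) ^ 2 : ℝ) : ℂ)) * d = ((x + α ^ 2 - τ ^ 2 : ℝ) : ℂ) * a +
      ((3 / 2 * x : ℝ) : ℂ) * b + ((x / 2 + (α * τ) ^ 2 : ℝ) : ℂ) * d by push_cast; ring]
    simp only [Complex.add_re, Complex.re_ofReal_mul]
  rw [h4, split] at d4
  rw [hPhi, d1, d2, d3, d4]
  field_simp
  ring
end

section
/- Let α > −1/4. There is a constant C > 0 such that for every f in the weighted space L_{3/4,1}(ℝ_+), the function (F_α f)(τ) = (2√π / cosh(πτ)) ∫_0^∞ Re[K_{α+iτ}(√x) I_{α−iτ}(√x)] f(x) dx is well defined (the integral converges absolutely for every τ ∈ ℝ), is a bounded continuous function of τ on ℝ, and satisfies sup_{τ∈ℝ} |(F_α f)(τ)| ≤ C ‖f‖_{3/4,1}. -/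
/-- The index transform
`(F_α f)(τ) = (2√π / cosh(πτ)) ∫_0^∞ Re[K_{α+iτ}(√x) I_{α−iτ}(√x)] f(x) dx`. -/
noncomputable def Ftrans (α : ℝ) (f : ℝ → ℝ) (τ : ℝ) : ℝ :=
  (2 * Real.sqrt Real.pi / Real.cosh (Real.pi * τ)) *
    ∫ x in Set.Ioi (0 : ℝ),
      (besselK (α + τ * Complex.I) (Real.sqrt x) *
        besselI (α - τ * Complex.I) (Real.sqrt x)).re * f x

open MeasureTheory Set

/-- The real Beta integral `∫₀¹ x^(a-1) (1-x)^(b-1) dx`. -/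
noncomputable def betaReal (a b : ℝ) : ℝ :=
  ∫ x in (0 : ℝ)..1, x ^ (a - 1) * (1 - x) ^ (b - 1)

lemma norm_betaIntegrand {u v : ℂ} {x : ℝ} (hx : x ∈ Ioo (0 : ℝ) 1) :
    ‖(x : ℂ) ^ (u - 1) * (1 - (x : ℂ)) ^ (v - 1)‖ =
      x ^ (u.re - 1) * (1 - x) ^ (v.re - 1) := by
  rw [norm_mul, Complex.norm_cpow_eq_rpow_re_of_pos hx.1, ← Complex.ofReal_one,
    ← Complex.ofReal_sub, Complex.norm_cpow_eq_rpow_re_of_pos (sub_pos.2 hx.2)]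
  simp

lemma intervalIntegrable_betaReal {a b : ℝ} (ha : 0 < a) (hb : 0 < b) :
    IntervalIntegrable (fun x : ℝ => x ^ (a - 1) * (1 - x) ^ (b - 1)) volume 0 1 := by
  have h := (Complex.betaIntegral_convergent (u := a) (v := b) (by simpa) (by simpa)).norm
  rw [intervalIntegrable_iff_integrableOn_Ioo_of_le zero_le_one] at h ⊢
  refine h.congr_fun (fun x hx => ?_) measurableSet_Ioo
  simpa using norm_betaIntegrand (u := a) (v := b) hx

lemma betaReal_nonneg (a b : ℝ) : 0 ≤ betaReal a b :=
  intervalIntegral.integral_nonneg zero_le_one fun x hx =>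
    mul_nonneg (Real.rpow_nonneg hx.1 _) (Real.rpow_nonneg (by linarith [hx.2]) _)

lemma betaReal_le_betaReal {a a' b : ℝ} (ha : 0 < a) (haa : a ≤ a') (hb : 0 < b) :
    betaReal a' b ≤ betaReal a b := by
  refine intervalIntegral.integral_mono_on_of_le_Ioo zero_le_one
    (intervalIntegrable_betaReal (ha.trans_le haa) hb) (intervalIntegrable_betaReal ha hb)
    fun x hx => ?_
  exact mul_le_mul_of_nonneg_right
    (Real.rpow_le_rpow_of_exponent_ge hx.1 hx.2.le (by linarith))
    (Real.rpow_nonneg (by linarith [hx.2]) _)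

lemma norm_betaIntegral_le (u v : ℂ) :
    ‖Complex.betaIntegral u v‖ ≤ betaReal u.re v.re := by
  refine (intervalIntegral.norm_integral_le_integral_norm zero_le_one).trans_eq ?_
  rw [betaReal, intervalIntegral.integral_of_le zero_le_one,
    intervalIntegral.integral_of_le zero_le_one, integral_Ioc_eq_integral_Ioo,
    integral_Ioc_eq_integral_Ioo]
  exact setIntegral_congr_fun measurableSet_Ioo fun x hx => norm_betaIntegrand hx

lemma norm_inv_Gamma_add_le {s t : ℂ} (hs : 0 < s.re) (ht : 0 < t.re) :
    ‖(Complex.Gamma (s + t))⁻¹‖ ≤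
      betaReal s.re t.re * ‖(Complex.Gamma s)⁻¹‖ * ‖(Complex.Gamma t)⁻¹‖ := by
  have hs' := Complex.Gamma_ne_zero_of_re_pos hs
  have ht' := Complex.Gamma_ne_zero_of_re_pos ht
  have hst : Complex.Gamma (s + t) ≠ 0 :=
    Complex.Gamma_ne_zero_of_re_pos (by rw [Complex.add_re]; positivity)
  have h : (Complex.Gamma (s + t))⁻¹ =
      Complex.betaIntegral s t * (Complex.Gamma s)⁻¹ * (Complex.Gamma t)⁻¹ := by
    have := Complex.Gamma_mul_Gamma_eq_betaIntegral hs ht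
    field_simp
    rw [this]
  rw [h, norm_mul, norm_mul]
  gcongr
  exact norm_betaIntegral_le s t

lemma norm_Gamma_le_Gamma_re {s : ℂ} (hs : 0 < s.re) :
    ‖Complex.Gamma s‖ ≤ Real.Gamma s.re := by
  rw [Complex.Gamma_eq_integral hs, Real.Gamma_eq_integral hs, Complex.GammaIntegral]
  refine (norm_integral_le_integral_norm _).trans_eq ?_
  refine setIntegral_congr_fun measurableSet_Ioi fun x hx => ?_
  simp only [norm_mul, Complex.norm_real, Complex.norm_cpow_eq_rpow_re_of_pos hx,
    Complex.sub_re, Complex.one_re, Real.norm_eq_abs, Real.abs_exp]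

lemma norm_sin_le_cosh_im (z : ℂ) : ‖Complex.sin z‖ ≤ Real.cosh z.im := by
  rw [Complex.sin, Real.cosh_eq, norm_div, norm_mul, Complex.norm_I, mul_one]
  have h := norm_sub_le (Complex.exp (-z * Complex.I)) (Complex.exp (z * Complex.I))
  simp only [Complex.norm_exp, Complex.mul_I_re, Complex.neg_im, neg_neg] at h
  rw [Complex.norm_ofNat]
  linarith

lemma norm_inv_Gamma_quarter_le (τ : ℝ) :
    ‖(Complex.Gamma (1 / 4 - τ * Complex.I))⁻¹‖ ≤
      Real.Gamma (3 / 4) / Real.pi * Real.cosh (Real.pi * τ) := by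
  set z : ℂ := 1 / 4 - τ * Complex.I with hz
  have hzre : z.re = 1 / 4 := by simp [hz]
  have hzim : z.im = -τ := by simp [hz]
  have h1 : (1 - z).re = 3 / 4 := by rw [Complex.sub_re, hzre]; norm_num
  have hz0 : Complex.Gamma z ≠ 0 := Complex.Gamma_ne_zero_of_re_pos (by rw [hzre]; norm_num)
  have hz1 : Complex.Gamma (1 - z) ≠ 0 :=
    Complex.Gamma_ne_zero_of_re_pos (by rw [h1]; norm_num)
  have hpi : (Real.pi : ℂ) ≠ 0 := by exact_mod_cast Real.pi_ne_zero
  have hr := Complex.Gamma_mul_Gamma_one_sub z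
  have hsin : Complex.sin (Real.pi * z) ≠ 0 := by
    intro h
    rw [h, div_zero] at hr
    exact mul_ne_zero hz0 hz1 hr
  have h : (Complex.Gamma z)⁻¹ = Complex.Gamma (1 - z) / Real.pi * Complex.sin (Real.pi * z) := by
    rw [eq_div_iff hsin] at hr
    field_simp
    rw [mul_comm z]
    linear_combination -hr
  rw [h, norm_mul, norm_div, Complex.norm_real, Real.norm_of_nonneg Real.pi_pos.le]
  have hs := norm_sin_le_cosh_im (Real.pi * z)
  rw [Complex.im_ofReal_mul, hzim, mul_neg, Real.cosh_neg] at hs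
  have hg := norm_Gamma_le_Gamma_re (s := 1 - z) (by rw [h1]; norm_num)
  rw [h1] at hg
  gcongr

lemma exists_norm_inv_Gamma_le {a : ℝ} (ha : 1 / 4 < a) :
    ∃ C > 0, ∀ τ : ℝ, ‖(Complex.Gamma (a - τ * Complex.I))⁻¹‖ ≤
      C * Real.cosh (Real.pi * τ) := by
  refine ⟨betaReal (1 / 4) (a - 1 / 4) * (Real.Gamma (3 / 4) / Real.pi) *
    ‖(Complex.Gamma ((a - 1 / 4 : ℝ) : ℂ))⁻¹‖ + 1, ?_, fun τ => ?_⟩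
  · have := betaReal_nonneg (1 / 4) (a - 1 / 4)
    have := Real.Gamma_pos_of_pos (s := 3 / 4) (by norm_num)
    positivity
  · have h := norm_inv_Gamma_add_le (s := 1 / 4 - τ * Complex.I) (t := ((a - 1 / 4 : ℝ) : ℂ))
      (by simp) (by rw [Complex.ofReal_re]; linarith)
    have e : (1 / 4 - τ * Complex.I + ((a - 1 / 4 : ℝ) : ℂ)) = a - τ * Complex.I := by
      push_cast; ring
    have e2 : (1 / 4 - τ * Complex.I : ℂ).re = 1 / 4 := by simp
    rw [e, e2, Complex.ofReal_re] at h
    refine h.trans ?_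
    have hc := Real.cosh_pos (Real.pi * τ)
    have hb := betaReal_nonneg (1 / 4) (a - 1 / 4)
    calc _ ≤ betaReal (1 / 4) (a - 1 / 4) *
          (Real.Gamma (3 / 4) / Real.pi * Real.cosh (Real.pi * τ)) *
          ‖(Complex.Gamma ((a - 1 / 4 : ℝ) : ℂ))⁻¹‖ := by
          gcongr
          exact norm_inv_Gamma_quarter_le τ
      _ ≤ _ := by nlinarith

lemma exists_rpow_mul_exp_neg_le {γ : ℝ} (hγ : 0 ≤ γ) :
    ∃ C > 0, ∀ s : ℝ, 0 ≤ s → s ^ γ * Real.exp (-(s / 2)) ≤ C := by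
  refine ⟨(2 * (γ + 1)) ^ γ, by positivity, fun s hs => ?_⟩
  have h1 : s / (2 * (γ + 1)) ≤ Real.exp (s / (2 * (γ + 1))) := by
    linarith [Real.add_one_le_exp (s / (2 * (γ + 1)))]
  have h2 := Real.rpow_le_rpow (by positivity) h1 hγ
  rw [Real.div_rpow hs (by positivity), ← Real.exp_mul, div_le_iff₀ (by positivity)] at h2
  have h3 : Real.exp (s / (2 * (γ + 1)) * γ) ≤ Real.exp (s / 2) := by
    apply Real.exp_le_exp.2
    rw [div_mul_eq_mul_div, div_le_div_iff₀ (by positivity) (by norm_num)]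
    nlinarith
  calc s ^ γ * Real.exp (-(s / 2))
      ≤ (Real.exp (s / 2) * (2 * (γ + 1)) ^ γ) * Real.exp (-(s / 2)) := by
        gcongr
        exact h2.trans (by gcongr)
    _ = (2 * (γ + 1)) ^ γ := by
        rw [Real.exp_neg]; field_simp

/-- Up to a constant factor depending on the order, the `k`-th term of the majorant of the series
of `I_ν(y)`, for `Re ν = α`, given by the Poisson integral representation. -/
noncomputable def besselIMajorant (α y : ℝ) (k : ℕ) : ℝ :=
  y ^ α * (y ^ (2 * k) / (2 * k).factorial) * betaReal (k + 1 / 2) (α + 1 / 2)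

lemma besselIMajorant_nonneg (α : ℝ) {y : ℝ} (hy : 0 < y) (k : ℕ) :
    0 ≤ besselIMajorant α y k :=
  mul_nonneg (by positivity) (betaReal_nonneg _ _)

lemma besselIMajorant_le {α : ℝ} (hα : -1 / 4 < α) {y : ℝ} (hy : 0 < y) (k : ℕ) :
    besselIMajorant α y k ≤
      y ^ α * (y ^ (2 * k) / (2 * k).factorial) * betaReal (1 / 2) (α + 1 / 2) := by
  unfold besselIMajorant
  gcongr
  exact betaReal_le_betaReal (by norm_num) (by linarith [(Nat.cast_nonneg k : (0 : ℝ) ≤ k)])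
    (by linarith)

lemma hasSum_rpow_mul_cosh (α y c : ℝ) :
    HasSum (fun k : ℕ => y ^ α * (y ^ (2 * k) / (2 * k).factorial) * c)
      (y ^ α * Real.cosh y * c) :=
  ((Real.hasSum_cosh y).mul_left _).mul_right _

lemma summable_besselIMajorant {α : ℝ} (hα : -1 / 4 < α) {y : ℝ} (hy : 0 < y) :
    Summable (besselIMajorant α y) :=
  Summable.of_nonneg_of_le (besselIMajorant_nonneg α hy) (besselIMajorant_le hα hy)
    (hasSum_rpow_mul_cosh α y _).summable

lemma tsum_besselIMajorant_le_of_le_one {α : ℝ} (hα : -1 / 4 < α) :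
    ∃ C > 0, ∀ y : ℝ, 0 < y → y ≤ 1 → ∑' k, besselIMajorant α y k ≤ C * y ^ α := by
  have hb := betaReal_nonneg (1 / 2) (α + 1 / 2)
  refine ⟨Real.cosh 1 * betaReal (1 / 2) (α + 1 / 2) + 1, ?_, fun y hy hy1 => ?_⟩
  · have := Real.cosh_pos 1
    positivity
  · have h1 := (summable_besselIMajorant hα hy).tsum_le_tsum (besselIMajorant_le hα hy)
      (hasSum_rpow_mul_cosh α y _).summable
    rw [(hasSum_rpow_mul_cosh α y _).tsum_eq] at h1
    have h2 : Real.cosh y ≤ Real.cosh 1 := by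
      rw [Real.cosh_le_cosh, abs_of_pos hy, abs_one]; exact hy1
    have h3 : 0 < y ^ α := by positivity
    calc _ ≤ _ := h1
      _ ≤ y ^ α * Real.cosh 1 * betaReal (1 / 2) (α + 1 / 2) := by gcongr
      _ ≤ _ := by nlinarith

lemma sum_pow_mul_pow_le_exp {y u : ℝ} (hy : 0 < y) (hu : u ∈ Ioo (0 : ℝ) 1) (n : ℕ) :
    ∑ k ∈ Finset.range n, y ^ (2 * k) / (2 * k).factorial * u ^ k ≤
      Real.exp y * Real.exp (-(y * (1 - u) / 2)) := by
  have h1 : ∑ k ∈ Finset.range n, y ^ (2 * k) / (2 * k).factorial * u ^ k =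
      ∑ k ∈ Finset.range n, (y * √u) ^ (2 * k) / (2 * k).factorial := by
    refine Finset.sum_congr rfl fun k _ => ?_
    rw [mul_pow, pow_mul (√u), Real.sq_sqrt hu.1.le]
    ring
  have hs : 0 ≤ √u := Real.sqrt_nonneg u
  rw [h1]
  refine (sum_le_hasSum _ (fun k _ => by positivity) (Real.hasSum_cosh (y * √u))).trans ?_
  rw [← Real.exp_add]
  have h2 : Real.cosh (y * √u) ≤ Real.exp (y * √u) := by
    rw [Real.cosh_eq]
    have : Real.exp (-(y * √u)) ≤ Real.exp (y * √u) :=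
      Real.exp_le_exp.2 (by linarith [mul_nonneg hy.le hs])
    linarith
  refine h2.trans (Real.exp_le_exp.2 ?_)
  have h3 : √u ≤ (1 + u) / 2 := by nlinarith [Real.sq_sqrt hu.1.le, sq_nonneg (√u - 1)]
  nlinarith

lemma sum_besselIMajorant_eq {α : ℝ} (hα : -1 / 4 < α) (y : ℝ) (n : ℕ) :
    ∑ k ∈ Finset.range n, besselIMajorant α y k =
      ∫ u in (0 : ℝ)..1, ∑ k ∈ Finset.range n, y ^ α * (y ^ (2 * k) / (2 * k).factorial) *
        (u ^ ((k : ℝ) + 1 / 2 - 1) * (1 - u) ^ (α + 1 / 2 - 1)) := by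
  rw [intervalIntegral.integral_finsetSum]
  · refine Finset.sum_congr rfl fun k _ => ?_
    rw [intervalIntegral.integral_const_mul, besselIMajorant, betaReal]
  · intro k _
    exact (intervalIntegrable_betaReal (by positivity) (by linarith)).const_mul _

lemma tsum_besselIMajorant_le_of_one_le {α : ℝ} (hα : -1 / 4 < α) :
    ∃ C > 0, ∀ y : ℝ, 1 ≤ y → ∑' k, besselIMajorant α y k ≤ C * Real.exp y := by
  set γ : ℝ := max α 0 with hγ
  have hγ0 : 0 ≤ γ := le_max_right _ _
  have hαγ : α ≤ γ := le_max_left _ _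
  have hm : -1 / 4 < α - γ := by
    rcases max_choice α 0 with h | h <;> rw [hγ, h] <;> linarith
  obtain ⟨D, hD, hDle⟩ := exists_rpow_mul_exp_neg_le hγ0
  have hb := betaReal_nonneg (1 / 2) (α - γ + 1 / 2)
  refine ⟨D * betaReal (1 / 2) (α - γ + 1 / 2) + 1, by positivity, fun y hy => ?_⟩
  have hy0 : 0 < y := by linarith
  refine (summable_besselIMajorant hα hy0).tsum_le_of_sum_range_le fun n => ?_
  rw [sum_besselIMajorant_eq hα]
  have key : ∫ u in (0 : ℝ)..1, ∑ k ∈ Finset.range n,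
        y ^ α * (y ^ (2 * k) / (2 * k).factorial) *
        (u ^ ((k : ℝ) + 1 / 2 - 1) * (1 - u) ^ (α + 1 / 2 - 1)) ≤
      ∫ u in (0 : ℝ)..1, (D * Real.exp y) *
        (u ^ ((1 / 2 : ℝ) - 1) * (1 - u) ^ (α - γ + 1 / 2 - 1)) := by
    refine intervalIntegral.integral_mono_on_of_le_Ioo zero_le_one ?_ ?_ fun u hu => ?_
    · rw [intervalIntegrable_iff]
      refine integrable_finsetSum _ fun k _ => intervalIntegrable_iff.1 ?_
      exact (intervalIntegrable_betaReal (by positivity) (by linarith)).const_mul _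
    · exact (intervalIntegrable_betaReal (by norm_num) (by linarith)).const_mul _
    · have hu1 : 0 < 1 - u := sub_pos.2 hu.2
      have hu0 := hu.1
      have e1 : ∑ k ∈ Finset.range n, y ^ α * (y ^ (2 * k) / (2 * k).factorial) *
            (u ^ ((k : ℝ) + 1 / 2 - 1) * (1 - u) ^ (α + 1 / 2 - 1)) =
          y ^ α * (u ^ ((1 / 2 : ℝ) - 1) * (1 - u) ^ (α + 1 / 2 - 1)) *
            ∑ k ∈ Finset.range n, y ^ (2 * k) / (2 * k).factorial * u ^ k := by
        rw [Finset.mul_sum]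
        refine Finset.sum_congr rfl fun k _ => ?_
        rw [add_sub_assoc, Real.rpow_add hu0, Real.rpow_natCast]
        ring
      have e2 : (1 - u) ^ (α + 1 / 2 - 1) = (1 - u) ^ γ * (1 - u) ^ (α - γ + 1 / 2 - 1) := by
        rw [← Real.rpow_add hu1]; congr 1; ring
      have e3 : y ^ α ≤ y ^ γ := Real.rpow_le_rpow_of_exponent_le hy hαγ
      have e4 := hDle (y * (1 - u)) (by positivity)
      rw [Real.mul_rpow hy0.le hu1.le] at e4
      rw [e1]
      calc _ ≤ y ^ γ * (u ^ ((1 / 2 : ℝ) - 1) * (1 - u) ^ (α + 1 / 2 - 1)) *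
            (Real.exp y * Real.exp (-(y * (1 - u) / 2))) := by
            gcongr
            exact sum_pow_mul_pow_le_exp hy0 hu n
        _ = (y ^ γ * (1 - u) ^ γ * Real.exp (-(y * (1 - u) / 2))) * (Real.exp y *
            (u ^ ((1 / 2 : ℝ) - 1) * (1 - u) ^ (α - γ + 1 / 2 - 1))) := by
            rw [e2]; ring
        _ ≤ D * (Real.exp y * (u ^ ((1 / 2 : ℝ) - 1) * (1 - u) ^ (α - γ + 1 / 2 - 1))) := by
            gcongr
        _ = _ := by ring
  refine key.trans ?_
  rw [intervalIntegral.integral_const_mul, ← betaReal]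
  nlinarith [Real.exp_pos y]

/-- The `k`-th term of the power series of `I_ν(y)`. -/
noncomputable def besselITerm (ν : ℂ) (y : ℝ) (k : ℕ) : ℂ :=
  ((y : ℂ) / 2) ^ (ν + 2 * (k : ℂ)) / ((Nat.factorial k : ℂ) * Complex.Gamma (ν + (k : ℂ) + 1))

lemma besselI_eq_tsum (ν : ℂ) (y : ℝ) : besselI ν y = ∑' k, besselITerm ν y k := rfl

lemma factorial_mul_Gamma_nat_add_half (k : ℕ) :
    (k.factorial : ℝ) * Real.Gamma (k + 1 / 2) * 2 ^ (2 * k) =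
      (2 * k).factorial * √Real.pi := by
  have h := Real.Gamma_mul_Gamma_add_half ((k : ℝ) + 1 / 2)
  have e1 : (k : ℝ) + 1 / 2 + 1 / 2 = k + 1 := by ring
  have e2 : 2 * ((k : ℝ) + 1 / 2) = ((2 * k : ℕ) : ℝ) + 1 := by push_cast; ring
  have e3 : (1 : ℝ) - (((2 * k : ℕ) : ℝ) + 1) = -((2 * k : ℕ) : ℝ) := by ring
  rw [e1, e2, e3, Real.Gamma_nat_eq_factorial, Real.Gamma_nat_eq_factorial,
    Real.rpow_neg (by norm_num), Real.rpow_natCast] at h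
  rw [mul_comm (k.factorial : ℝ), h]
  field_simp

lemma exists_norm_besselITerm_le {α : ℝ} (hα : -1 / 4 < α) :
    ∃ C > 0, ∀ (τ y : ℝ) (k : ℕ), 0 < y →
      ‖besselITerm (α - τ * Complex.I) y k‖ ≤
        C * Real.cosh (Real.pi * τ) * besselIMajorant α y k := by
  obtain ⟨C, hC, hCle⟩ := exists_norm_inv_Gamma_le (a := α + 1 / 2) (by linarith)
  refine ⟨C * 2 ^ (-α) / √Real.pi, by positivity, fun τ y k hy => ?_⟩
  set G := Real.Gamma ((k : ℝ) + 1 / 2) with hG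
  have hGpos : 0 < G := Real.Gamma_pos_of_pos (by positivity)
  have hb := betaReal_nonneg ((k : ℝ) + 1 / 2) (α + 1 / 2)
  have hre : (((α + 1 / 2 : ℝ) : ℂ) - τ * Complex.I).re = α + 1 / 2 := by simp
  have h := norm_inv_Gamma_add_le (s := (((k : ℝ) + 1 / 2 : ℝ) : ℂ))
    (t := ((α + 1 / 2 : ℝ) : ℂ) - τ * Complex.I)
    (by rw [Complex.ofReal_re]; positivity) (by rw [hre]; linarith)
  have e : (((k : ℝ) + 1 / 2 : ℝ) : ℂ) + (((α + 1 / 2 : ℝ) : ℂ) - τ * Complex.I) =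
      α - τ * Complex.I + k + 1 := by push_cast; ring
  rw [e, hre, Complex.ofReal_re, Complex.Gamma_ofReal, ← Complex.ofReal_inv, Complex.norm_real,
    ← hG, Real.norm_of_nonneg (inv_nonneg.2 hGpos.le)] at h
  have h' := h.trans (mul_le_mul_of_nonneg_left (hCle τ) (by positivity))
  have hpow : ‖((y : ℂ) / 2) ^ (α - τ * Complex.I + 2 * (k : ℂ))‖ =
      y ^ α * 2 ^ (-α) * (y ^ (2 * k) / 2 ^ (2 * k)) := by
    have : ((y : ℂ) / 2) = ((y / 2 : ℝ) : ℂ) := by push_cast; rfl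
    have hre2 : ((α : ℂ) - τ * Complex.I + 2 * (k : ℂ)).re = α + ((2 * k : ℕ) : ℝ) := by simp
    rw [this, Complex.norm_cpow_eq_rpow_re_of_pos (by positivity), hre2,
      Real.rpow_add (by positivity), Real.rpow_natCast, Real.div_rpow hy.le (by norm_num),
      div_pow, Real.rpow_neg (by norm_num), div_eq_mul_inv (y ^ α)]
  have hfac := factorial_mul_Gamma_nat_add_half k
  have hk : 0 < (k.factorial : ℝ) := by positivity
  rw [besselITerm, div_eq_mul_inv, mul_inv, norm_mul, norm_mul, hpow, norm_inv,
    Complex.norm_natCast]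
  calc _ ≤ y ^ α * 2 ^ (-α) * (y ^ (2 * k) / 2 ^ (2 * k)) * ((k.factorial : ℝ)⁻¹ *
        (betaReal ((k : ℝ) + 1 / 2) (α + 1 / 2) * G⁻¹ * (C * Real.cosh (Real.pi * τ)))) := by
        gcongr
    _ = C * Real.cosh (Real.pi * τ) * 2 ^ (-α) * y ^ α * y ^ (2 * k) *
        betaReal ((k : ℝ) + 1 / 2) (α + 1 / 2) * (k.factorial * G * 2 ^ (2 * k))⁻¹ := by
        rw [mul_inv, mul_inv]; ring
    _ = _ := by
        rw [hfac, besselIMajorant, mul_inv]; ring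

lemma hasSum_besselITerm {α : ℝ} (hα : -1 / 4 < α) (τ : ℝ) {y : ℝ} (hy : 0 < y) :
    HasSum (besselITerm (α - τ * Complex.I) y) (besselI (α - τ * Complex.I) y) := by
  obtain ⟨C, -, hCle⟩ := exists_norm_besselITerm_le hα
  exact (Summable.of_norm_bounded ((summable_besselIMajorant hα hy).mul_left _)
    fun k => hCle τ y k hy).hasSum

lemma exists_norm_besselI_le {α : ℝ} (hα : -1 / 4 < α) :
    ∃ C > 0, ∀ τ y : ℝ, 0 < y →
      ‖besselI (α - τ * Complex.I) y‖ ≤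
        C * Real.cosh (Real.pi * τ) * ∑' k, besselIMajorant α y k := by
  obtain ⟨C, hC, hCle⟩ := exists_norm_besselITerm_le hα
  refine ⟨C, hC, fun τ y hy => ?_⟩
  rw [besselI_eq_tsum, ← tsum_mul_left]
  exact tsum_of_norm_bounded ((summable_besselIMajorant hα hy).mul_left _).hasSum
    fun k => hCle τ y k hy

lemma continuous_besselITerm (α : ℝ) {y : ℝ} (hy : 0 < y) (k : ℕ) :
    Continuous fun τ : ℝ => besselITerm (α - τ * Complex.I) y k := by
  have hy2 : (y : ℂ) / 2 ≠ 0 := by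
    simpa using hy.ne'
  have hG : Continuous fun τ : ℝ => (Complex.Gamma (α - τ * Complex.I + k + 1))⁻¹ :=
    Complex.differentiable_one_div_Gamma.continuous.comp (by fun_prop)
  have hp : Continuous fun τ : ℝ => ((y : ℂ) / 2) ^ (α - τ * Complex.I + 2 * (k : ℂ)) :=
    Continuous.const_cpow (by fun_prop) (Or.inl hy2)
  simp only [besselITerm, div_eq_mul_inv _ (_ * Complex.Gamma _), mul_inv]
  exact hp.mul (continuous_const.mul hG)

lemma continuous_besselI {α : ℝ} (hα : -1 / 4 < α) {y : ℝ} (hy : 0 < y) :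
    Continuous fun τ : ℝ => besselI (α - τ * Complex.I) y := by
  obtain ⟨C, hC, hCle⟩ := exists_norm_besselITerm_le hα
  have hcosh : Continuous fun τ : ℝ => (Real.cosh (Real.pi * τ) : ℂ) :=
    Complex.continuous_ofReal.comp (Real.continuous_cosh.comp (by fun_prop))
  have hne : ∀ τ : ℝ, (Real.cosh (Real.pi * τ) : ℂ) ≠ 0 := fun τ =>
    Complex.ofReal_ne_zero.2 (Real.cosh_pos _).ne'
  have h : Continuous fun τ : ℝ =>
      ∑' k, besselITerm (α - τ * Complex.I) y k / (Real.cosh (Real.pi * τ) : ℂ) := by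
    refine continuous_tsum (fun k => (continuous_besselITerm α hy k).div hcosh hne)
      ((summable_besselIMajorant hα hy).mul_left C) fun k τ => ?_
    rw [norm_div, Complex.norm_real, Real.norm_of_nonneg (Real.cosh_pos _).le,
      div_le_iff₀ (Real.cosh_pos _)]
    linarith [hCle τ y k hy]
  refine (h.mul hcosh).congr fun τ => ?_
  simp only [Pi.mul_apply]
  rw [tsum_div_const, div_mul_cancel₀ _ (hne τ), besselI_eq_tsum]

lemma aestronglyMeasurable_besselI_sqrt {α : ℝ} (hα : -1 / 4 < α) (τ : ℝ) :
    AEStronglyMeasurable (fun x : ℝ => besselI (α - τ * Complex.I) (√x))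
      (volume.restrict (Ioi 0)) := by
  refine aestronglyMeasurable_of_tendsto_ae Filter.atTop
    (f := fun n x => ∑ k ∈ Finset.range n, besselITerm (α - τ * Complex.I) (√x) k)
    (fun n => ?_) ?_
  · refine (Finset.measurable_sum _ fun k _ => ?_).aestronglyMeasurable
    unfold besselITerm
    fun_prop
  · filter_upwards [ae_restrict_mem measurableSet_Ioi] with x hx
    exact (hasSum_besselITerm hα τ (Real.sqrt_pos.2 hx)).tendsto_sum_nat

lemma norm_cosh_mul_le_s1 (α τ : ℝ) {t : ℝ} (ht : 0 ≤ t) :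
    ‖Complex.cosh ((α + τ * Complex.I) * t)‖ ≤ Real.exp (|α| * t) := by
  rw [Complex.cosh, norm_div, Complex.norm_ofNat]
  have h := norm_add_le (Complex.exp ((α + τ * Complex.I) * t))
    (Complex.exp (-((α + τ * Complex.I) * t)))
  have e : ((α + τ * Complex.I) * t).re = α * t := by simp
  rw [Complex.norm_exp, Complex.norm_exp, Complex.neg_re, e] at h
  have h1 : Real.exp (α * t) ≤ Real.exp (|α| * t) :=
    Real.exp_le_exp.2 (mul_le_mul_of_nonneg_right (le_abs_self α) ht)
  have h2 : Real.exp (-(α * t)) ≤ Real.exp (|α| * t) :=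
    Real.exp_le_exp.2 (by nlinarith [neg_abs_le α])
  linarith

lemma norm_besselKIntegrand_le (α τ y : ℝ) {t : ℝ} (ht : 0 ≤ t) :
    ‖Complex.exp (-(y : ℂ) * Real.cosh t) * Complex.cosh ((α + τ * Complex.I) * t)‖ ≤
      Real.exp (-y * Real.cosh t) * Real.exp (|α| * t) := by
  rw [norm_mul, Complex.norm_exp]
  have : (-(y : ℂ) * (Real.cosh t : ℂ)).re = -y * Real.cosh t := by
    rw [← Complex.ofReal_neg, ← Complex.ofReal_mul, Complex.ofReal_re]
  rw [this]
  gcongr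
  exact norm_cosh_mul_le_s1 α τ ht

lemma half_exp_le_cosh (t : ℝ) : Real.exp t / 2 ≤ Real.cosh t := by
  rw [Real.cosh_eq]
  linarith [Real.exp_pos (-t)]

lemma one_add_half_sq_le_cosh (t : ℝ) : 1 + t ^ 2 / 2 ≤ Real.cosh t := by
  have h := sum_le_hasSum (Finset.range 2)
    (fun k _ => by rw [pow_mul]; positivity) (Real.hasSum_cosh t)
  simpa [Finset.sum_range_succ] using h

lemma exists_exp_neg_mul_cosh_le (a : ℝ) {β : ℝ} (hβ : 0 ≤ β) :
    ∃ C > 0, ∀ y t : ℝ, 0 < y →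
      Real.exp (-y * Real.cosh t) * Real.exp (a * t) ≤
        C * y ^ (-β) * Real.exp (-(β - a) * t) := by
  obtain ⟨D, hD, hDle⟩ := exists_rpow_mul_exp_neg_le hβ
  refine ⟨D, hD, fun y t hy => ?_⟩
  have h1 := hDle (y * Real.exp t) (by positivity)
  rw [Real.mul_rpow hy.le (Real.exp_pos t).le, ← Real.exp_mul] at h1
  have h2 : Real.exp (-y * Real.cosh t) ≤ Real.exp (-(y * Real.exp t / 2)) :=
    Real.exp_le_exp.2 (by nlinarith [half_exp_le_cosh t])
  have h3 : Real.exp (-(y * Real.exp t / 2)) ≤ D * y ^ (-β) * Real.exp (-(β * t)) := by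
    rw [Real.rpow_neg hy.le, Real.exp_neg (β * t), ← div_eq_mul_inv, ← div_eq_mul_inv,
      div_div, le_div_iff₀ (by positivity), mul_comm β t]
    linarith
  calc _ ≤ D * y ^ (-β) * Real.exp (-(β * t)) * Real.exp (a * t) := by
        gcongr
        exact h2.trans h3
    _ = _ := by
        rw [mul_assoc, ← Real.exp_add]; congr 2; ring

lemma exists_norm_besselK_le (α : ℝ) {β : ℝ} (hβ : |α| < β) :
    ∃ C > 0, ∀ τ y : ℝ, 0 < y → ‖besselK (α + τ * Complex.I) y‖ ≤ C * y ^ (-β) := by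
  obtain ⟨D, hD, hDle⟩ := exists_exp_neg_mul_cosh_le |α| ((abs_nonneg α).trans hβ.le)
  have hd : 0 < β - |α| := sub_pos.2 hβ
  refine ⟨D / (β - |α|), by positivity, fun τ y hy => ?_⟩
  have hint : IntegrableOn (fun t => D * y ^ (-β) * Real.exp (-(β - |α|) * t)) (Ioi 0) :=
    (integrableOn_exp_mul_Ioi (neg_neg_of_pos hd) 0).const_mul _
  refine (norm_integral_le_of_norm_le hint ?_).trans_eq ?_
  · filter_upwards [ae_restrict_mem measurableSet_Ioi] with t ht
    exact (norm_besselKIntegrand_le α τ y (le_of_lt ht)).trans (hDle y t hy)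
  · rw [integral_const_mul, integral_exp_mul_Ioi (neg_neg_of_pos hd)]
    simp only [mul_zero, Real.exp_zero, neg_div_neg_eq]
    ring

lemma exists_norm_besselK_le_of_one_le (α : ℝ) :
    ∃ C > 0, ∀ τ y : ℝ, 1 ≤ y →
      ‖besselK (α + τ * Complex.I) y‖ ≤ C * Real.exp (-y) * y ^ (-(1 / 2) : ℝ) := by
  obtain ⟨D, hD, hDle⟩ := exists_exp_neg_mul_cosh_le |α| (abs_nonneg α)
  set E := D * (1 / 2 : ℝ) ^ (-|α|) * Real.exp (1 / 2) with hE
  refine ⟨E * √Real.pi, by positivity, fun τ y hy => ?_⟩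
  have hy0 : 0 < y := by linarith
  have hint : Integrable (fun t : ℝ => E * Real.exp (-y) * Real.exp (-(y / 4) * t ^ 2)) :=
    (integrable_exp_neg_mul_sq (by positivity)).const_mul _
  refine (norm_integral_le_of_norm_le (hint.integrableOn (s := Ioi 0)) ?_).trans_eq ?_
  · filter_upwards [ae_restrict_mem measurableSet_Ioi] with t ht
    refine (norm_besselKIntegrand_le α τ y (le_of_lt ht)).trans ?_
    have h1 := hDle (1 / 2) t (by norm_num)
    rw [sub_self, neg_zero, zero_mul, Real.exp_zero, mul_one] at h1
    have hc := one_add_half_sq_le_cosh t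
    have h2 : Real.exp (-y * Real.cosh t) ≤
        Real.exp (-(1 / 2) * Real.cosh t) * Real.exp (1 / 2) * Real.exp (-y) *
          Real.exp (-(y / 4) * t ^ 2) := by
      rw [← Real.exp_add, ← Real.exp_add, ← Real.exp_add]
      apply Real.exp_le_exp.2
      nlinarith [mul_nonneg (sub_nonneg.2 hy) (by nlinarith : 0 ≤ Real.cosh t - 1),
        mul_nonneg hy0.le (sub_nonneg.2 hc)]
    calc _ ≤ Real.exp (-(1 / 2) * Real.cosh t) * Real.exp (1 / 2) * Real.exp (-y) *
          Real.exp (-(y / 4) * t ^ 2) * Real.exp (|α| * t) := by gcongr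
      _ = (Real.exp (-(1 / 2) * Real.cosh t) * Real.exp (|α| * t)) * Real.exp (1 / 2) *
          Real.exp (-y) * Real.exp (-(y / 4) * t ^ 2) := by ring
      _ ≤ _ := by rw [hE]; gcongr
  · rw [integral_const_mul, integral_gaussian_Ioi, Real.rpow_neg hy0.le,
      ← Real.sqrt_eq_rpow, Real.sqrt_div Real.pi_pos.le, Real.sqrt_div hy0.le]
    have : √(4 : ℝ) = 2 := by
      rw [show (4 : ℝ) = 2 ^ 2 by norm_num, Real.sqrt_sq (by norm_num)]
    rw [this]
    have : √y ≠ 0 := (Real.sqrt_pos.2 hy0).ne'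
    field_simp

lemma continuous_besselK (α : ℝ) {y : ℝ} (hy : 0 < y) :
    Continuous fun τ : ℝ => besselK (α + τ * Complex.I) y := by
  obtain ⟨D, hD, hDle⟩ := exists_exp_neg_mul_cosh_le |α| (β := |α| + 1) (by positivity)
  refine continuous_of_dominated
    (bound := fun t => D * y ^ (-(|α| + 1)) * Real.exp (-(|α| + 1 - |α|) * t))
    (fun τ => ?_) (fun τ => ?_) ?_ (Filter.Eventually.of_forall fun t => ?_)
  · refine Continuous.aestronglyMeasurable ?_
    fun_prop
  · filter_upwards [ae_restrict_mem measurableSet_Ioi] with t ht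
    exact (norm_besselKIntegrand_le α τ y (le_of_lt ht)).trans (hDle y t hy)
  · exact (integrableOn_exp_mul_Ioi (by simp) 0).const_mul _
  · fun_prop

lemma stronglyMeasurable_besselK (ν : ℂ) : StronglyMeasurable (besselK ν) := by
  refine StronglyMeasurable.integral_prod_right (Continuous.stronglyMeasurable ?_)
  unfold Function.uncurry
  fun_prop

lemma exists_norm_besselK_mul_norm_besselI_le {α : ℝ} (hα : -1 / 4 < α) :
    ∃ C > 0, ∀ τ y : ℝ, 0 < y →
      ‖besselK (α + τ * Complex.I) y‖ * ‖besselI (α - τ * Complex.I) y‖ ≤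
        C * Real.cosh (Real.pi * τ) * y ^ (-(1 / 2) : ℝ) := by
  obtain ⟨A, hA, hAle⟩ := exists_norm_besselI_le hα
  obtain ⟨B₀, hB₀, hB₀le⟩ := tsum_besselIMajorant_le_of_le_one hα
  obtain ⟨B₁, hB₁, hB₁le⟩ := tsum_besselIMajorant_le_of_one_le hα
  have hβ : |α| < α + 1 / 2 := abs_lt.2 ⟨by linarith, by linarith⟩
  obtain ⟨D₀, hD₀, hD₀le⟩ := exists_norm_besselK_le α hβ
  obtain ⟨D₁, hD₁, hD₁le⟩ := exists_norm_besselK_le_of_one_le α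
  refine ⟨max (A * B₀ * D₀) (A * B₁ * D₁), by positivity, fun τ y hy => ?_⟩
  have hc := Real.cosh_pos (Real.pi * τ)
  rcases le_total y 1 with h | h
  · calc _ ≤ D₀ * y ^ (-(α + 1 / 2)) * (A * Real.cosh (Real.pi * τ) * (B₀ * y ^ α)) := by
          gcongr
          · exact hD₀le τ y hy
          · refine (hAle τ y hy).trans ?_
            gcongr
            exact hB₀le y hy h
      _ = A * B₀ * D₀ * Real.cosh (Real.pi * τ) * (y ^ (-(α + 1 / 2)) * y ^ α) := by ring
      _ = A * B₀ * D₀ * Real.cosh (Real.pi * τ) * y ^ (-(1 / 2) : ℝ) := by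
          rw [← Real.rpow_add hy]; congr 2; ring
      _ ≤ _ := by
          gcongr
          exact le_max_left _ _
  · calc _ ≤ D₁ * Real.exp (-y) * y ^ (-(1 / 2) : ℝ) *
          (A * Real.cosh (Real.pi * τ) * (B₁ * Real.exp y)) := by
          gcongr
          · exact hD₁le τ y h
          · refine (hAle τ y hy).trans ?_
            gcongr
            exact hB₁le y h
      _ = A * B₁ * D₁ * Real.cosh (Real.pi * τ) * y ^ (-(1 / 2) : ℝ) *
          (Real.exp (-y) * Real.exp y) := by ring
      _ = A * B₁ * D₁ * Real.cosh (Real.pi * τ) * y ^ (-(1 / 2) : ℝ) := by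
          rw [← Real.exp_add, neg_add_cancel, Real.exp_zero, mul_one]
      _ ≤ _ := by
          gcongr
          exact le_max_right _ _

/-- The kernel `Re[K_{α+iτ}(√x) I_{α-iτ}(√x)]` of the index transform. -/
noncomputable def indexKernel (α τ x : ℝ) : ℝ :=
  (besselK (α + τ * Complex.I) (√x) * besselI (α - τ * Complex.I) (√x)).re

lemma exists_abs_indexKernel_le {α : ℝ} (hα : -1 / 4 < α) :
    ∃ C > 0, ∀ τ x : ℝ, 0 < x →
      |indexKernel α τ x| ≤ C * Real.cosh (Real.pi * τ) * x ^ ((3 : ℝ) / 4 - 1) := by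
  obtain ⟨C, hC, hCle⟩ := exists_norm_besselK_mul_norm_besselI_le hα
  refine ⟨C, hC, fun τ x hx => (Complex.abs_re_le_norm _).trans ?_⟩
  have h := hCle τ (√x) (Real.sqrt_pos.2 hx)
  rw [Real.sqrt_eq_rpow, ← Real.rpow_mul hx.le,
    show (1 / 2 * -(1 / 2) : ℝ) = 3 / 4 - 1 by norm_num, ← Real.sqrt_eq_rpow] at h
  rwa [norm_mul]

lemma aestronglyMeasurable_indexKernel {α : ℝ} (hα : -1 / 4 < α) (τ : ℝ) :
    AEStronglyMeasurable (indexKernel α τ) (volume.restrict (Ioi 0)) := by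
  have hK : AEStronglyMeasurable (fun x : ℝ => besselK (α + τ * Complex.I) (√x))
      (volume.restrict (Ioi 0)) :=
    ((stronglyMeasurable_besselK _).comp_measurable
      Real.continuous_sqrt.measurable).aestronglyMeasurable
  exact Complex.continuous_re.comp_aestronglyMeasurable
    (hK.mul (aestronglyMeasurable_besselI_sqrt hα τ))

lemma continuous_indexKernel {α : ℝ} (hα : -1 / 4 < α) {x : ℝ} (hx : 0 < x) :
    Continuous fun τ => indexKernel α τ x :=
  Complex.continuous_re.comp
    ((continuous_besselK α (Real.sqrt_pos.2 hx)).mul (continuous_besselI hα (Real.sqrt_pos.2 hx)))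

lemma Ftrans_eq_integral (α : ℝ) (f : ℝ → ℝ) (τ : ℝ) :
    Ftrans α f τ = ∫ x in Ioi (0 : ℝ),
      2 * √Real.pi / Real.cosh (Real.pi * τ) * (indexKernel α τ x * f x) := by
  rw [integral_const_mul]; rfl

/-- Theorem 1, first part: for `α > −1/4`, the transform `F_α`
is well defined on `L_{3/4,1}(ℝ₊)` (the defining integral converges absolutely
for every `τ`), `F_α f` is continuous and bounded, and
`sup_τ |(F_α f)(τ)| ≤ C‖f‖_{3/4,1}`. -/
theorem statement1 (α : ℝ) (hα : α > -1/4) :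
    ∃ C > 0, ∀ f : ℝ → ℝ,
      MeasureTheory.AEStronglyMeasurable f (MeasureTheory.volume.restrict (Set.Ioi 0)) →
      MeasureTheory.IntegrableOn (fun x : ℝ => |f x| * x ^ ((3 : ℝ)/4 - 1)) (Set.Ioi 0) →
      (∀ τ : ℝ, MeasureTheory.IntegrableOn
          (fun x : ℝ => (besselK (α + τ * Complex.I) (Real.sqrt x) *
            besselI (α - τ * Complex.I) (Real.sqrt x)).re * f x) (Set.Ioi 0)) ∧
      Continuous (Ftrans α f) ∧
      (∀ τ : ℝ, |Ftrans α f τ| ≤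
        C * ∫ x in Set.Ioi (0 : ℝ), |f x| * x ^ ((3 : ℝ)/4 - 1)) := by
  have hα' : -1 / 4 < α := hα
  obtain ⟨C, hC, hCle⟩ := exists_abs_indexKernel_le hα'
  refine ⟨2 * √Real.pi * C, by positivity, fun f hf hint => ?_⟩
  have hmeas : ∀ τ : ℝ, AEStronglyMeasurable (fun x => indexKernel α τ x * f x)
      (volume.restrict (Ioi 0)) := fun τ =>
    (aestronglyMeasurable_indexKernel hα' τ).mul hf
  have hbound : ∀ τ x : ℝ, 0 < x → ‖indexKernel α τ x * f x‖ ≤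
      C * Real.cosh (Real.pi * τ) * (|f x| * x ^ ((3 : ℝ) / 4 - 1)) := fun τ x hx => by
    rw [norm_mul, Real.norm_eq_abs, Real.norm_eq_abs]
    calc _ ≤ C * Real.cosh (Real.pi * τ) * x ^ ((3 : ℝ) / 4 - 1) * |f x| := by
          gcongr
          exact hCle τ x hx
      _ = _ := by ring
  have hbound' : ∀ τ x : ℝ, 0 < x →
      ‖2 * √Real.pi / Real.cosh (Real.pi * τ) * (indexKernel α τ x * f x)‖ ≤
        2 * √Real.pi * C * (|f x| * x ^ ((3 : ℝ) / 4 - 1)) := fun τ x hx => by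
    have hc := Real.cosh_pos (Real.pi * τ)
    rw [norm_mul, Real.norm_of_nonneg (by positivity)]
    calc _ ≤ 2 * √Real.pi / Real.cosh (Real.pi * τ) *
          (C * Real.cosh (Real.pi * τ) * (|f x| * x ^ ((3 : ℝ) / 4 - 1))) := by
          gcongr
          exact hbound τ x hx
      _ = _ := by field_simp
  have hint' := hint.const_mul (2 * √Real.pi * C)
  refine ⟨fun τ => ?_, ?_, fun τ => ?_⟩
  · refine (hint.const_mul (C * Real.cosh (Real.pi * τ))).mono' (hmeas τ) ?_
    filter_upwards [ae_restrict_mem measurableSet_Ioi] with x hx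
    exact hbound τ x hx
  · rw [funext (Ftrans_eq_integral α f)]
    refine continuous_of_dominated (fun τ => (hmeas τ).const_mul _) (fun τ => ?_) hint' ?_
    · filter_upwards [ae_restrict_mem measurableSet_Ioi] with x hx
      exact hbound' τ x hx
    · filter_upwards [ae_restrict_mem measurableSet_Ioi] with x hx
      refine Continuous.mul (Continuous.div continuous_const
        (Real.continuous_cosh.comp (by fun_prop)) fun τ => (Real.cosh_pos _).ne') ?_
      exact (continuous_indexKernel hα' hx).mul continuous_const
  · rw [Ftrans_eq_integral, ← integral_const_mul, ← Real.norm_eq_abs]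
    refine norm_integral_le_of_norm_le hint' ?_
    filter_upwards [ae_restrict_mem measurableSet_Ioi] with x hx
    exact hbound' τ x hx
end

section
/- Let α > −1/4 and let g be measurable on ℝ with ∫_{−∞}^∞ |g(τ)|/cosh(πτ) dτ < ∞. Then x ↦ x^{1/4} (G_α g)(x) is a bounded continuous function on (0,∞), and there is a constant C > 0 (independent of g) such that sup_{x>0} x^{1/4} |(G_α g)(x)| ≤ C ∫_{−∞}^∞ |g(τ)|/cosh(πτ) dτ. -/
/-- The index transform
`(G_α g)(x) = 2√π ∫_ℝ Re[K_{α+iτ}(√x) I_{α−iτ}(√x)] g(τ)/cosh(πτ) dτ`. -/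
noncomputable def Gtrans (α : ℝ) (g : ℝ → ℝ) (x : ℝ) : ℝ :=
  2 * Real.sqrt Real.pi *
    ∫ τ : ℝ, (besselK (α + τ * Complex.I) (Real.sqrt x) *
      besselI (α - τ * Complex.I) (Real.sqrt x)).re * g τ / Real.cosh (Real.pi * τ)

open MeasureTheory Set Filter Topology

/-- The entire function `∑ (-x)^k / (k! Γ(l+k+1))`, so that
`J_l(z) = (z/2)^l * besselClifford l (z^2/4)`. -/
noncomputable def besselClifford (l x : ℝ) : ℝ :=
  ∑' k : ℕ, (-x) ^ k / ((k.factorial : ℝ) * Real.Gamma (l + k + 1))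

lemma inv_Gamma_add_nat_le {l : ℝ} (hl : -1/2 < l) (n : ℕ) :
    (Real.Gamma (l + n + 1))⁻¹ ≤ 2 ^ n * (Real.Gamma (l + 1))⁻¹ := by
  induction n with
  | zero => simp
  | succ n ih =>
    have hn : (0 : ℝ) ≤ n := n.cast_nonneg
    have h1 : Real.Gamma (l + (n + 1 : ℕ) + 1) = (l + n + 1) * Real.Gamma (l + n + 1) := by
      rw [← Real.Gamma_add_one (by linarith)]
      push_cast
      ring_nf
    have h2 : (l + n + 1)⁻¹ ≤ 2 := by
      rw [inv_le_comm₀ (by linarith) (by norm_num)]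
      linarith
    have h3 : 0 < Real.Gamma (l + n + 1) := Real.Gamma_pos_of_pos (by linarith)
    rw [h1, mul_inv, pow_succ']
    calc (l + n + 1)⁻¹ * (Real.Gamma (l + n + 1))⁻¹
        ≤ 2 * (2 ^ n * (Real.Gamma (l + 1))⁻¹) := by gcongr
      _ = _ := by ring

lemma Gamma_add_nat_pos {l : ℝ} (hl : -1/2 < l) (n : ℕ) : 0 < Real.Gamma (l + n + 1) :=
  Real.Gamma_pos_of_pos (by have : (0 : ℝ) ≤ n := n.cast_nonneg
                            linarith)

lemma norm_besselClifford_term_le {l : ℝ} (hl : -1/2 < l) (x : ℝ) (k : ℕ) :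
    ‖(-x) ^ k / ((k.factorial : ℝ) * Real.Gamma (l + k + 1))‖ ≤
      (Real.Gamma (l + 1))⁻¹ * ((2 * |x|) ^ k / k.factorial) := by
  have h3 := Gamma_add_nat_pos hl k
  rw [norm_div, norm_pow, norm_neg, Real.norm_eq_abs x,
    Real.norm_of_nonneg (r := (k.factorial : ℝ) * _) (by positivity), div_eq_mul_inv, mul_inv]
  calc |x| ^ k * ((k.factorial : ℝ)⁻¹ * (Real.Gamma (l + k + 1))⁻¹)
      ≤ |x| ^ k * ((k.factorial : ℝ)⁻¹ * (2 ^ k * (Real.Gamma (l + 1))⁻¹)) := by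
        gcongr
        exact inv_Gamma_add_nat_le hl k
    _ = _ := by rw [mul_pow]; ring

lemma summable_besselClifford {l : ℝ} (hl : -1/2 < l) (x : ℝ) :
    Summable fun k : ℕ => (-x) ^ k / ((k.factorial : ℝ) * Real.Gamma (l + k + 1)) :=
  Summable.of_norm_bounded ((Real.summable_pow_div_factorial _).mul_left _)
    (norm_besselClifford_term_le hl x)

/-- Taylor expansion of `besselClifford`. -/
lemma hasSum_besselClifford_taylor {l : ℝ} (hl : -1/2 < l) (x c : ℝ) :
    HasSum (fun k : ℕ => c ^ k / k.factorial * besselClifford (l + k) x)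
      (besselClifford l (x - c)) := by
  let f : ℕ × ℕ → ℝ := fun p => c ^ p.1 / p.1.factorial * ((-x) ^ p.2 /
    ((p.2.factorial : ℝ) * Real.Gamma (l + p.1 + p.2 + 1)))
  have hf : Summable f := by
    refine Summable.of_norm_bounded (g := fun p : ℕ × ℕ => (Real.Gamma (l + 1))⁻¹ *
      (((2 * |c|) ^ p.1 / p.1.factorial) * ((2 * |x|) ^ p.2 / p.2.factorial)))
      (((Real.summable_pow_div_factorial _).mul_of_nonneg (Real.summable_pow_div_factorial _)
        (fun _ => by positivity) (fun _ => by positivity)).mul_left _) ?_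
    rintro ⟨j, k⟩
    have h3 := Gamma_add_nat_pos hl (j + k)
    have h4 := inv_Gamma_add_nat_le hl (j + k)
    simp only [f]
    push_cast [← add_assoc] at h3 h4
    rw [norm_mul, norm_div, norm_div, norm_pow, norm_pow, norm_neg, norm_mul,
      Real.norm_eq_abs c, Real.norm_eq_abs x, Real.norm_of_nonneg h3.le,
      Real.norm_of_nonneg (by positivity), Real.norm_of_nonneg (by positivity)]
    calc |c| ^ j / j.factorial * (|x| ^ k / (k.factorial * Real.Gamma (l + j + k + 1)))
        = |c| ^ j / j.factorial * (|x| ^ k / k.factorial) * (Real.Gamma (l + j + k + 1))⁻¹ := by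
          field_simp
      _ ≤ |c| ^ j / j.factorial * (|x| ^ k / k.factorial) *
          (2 ^ (j + k) * (Real.Gamma (l + 1))⁻¹) := by gcongr
      _ = _ := by rw [mul_pow, mul_pow, pow_add]; ring
  have h1 : HasSum (fun k : ℕ => c ^ k / k.factorial * besselClifford (l + k) x) (∑' p, f p) := by
    refine hf.hasSum.prod_fiberwise fun j => ?_
    have hj : (0 : ℝ) ≤ j := j.cast_nonneg
    exact (summable_besselClifford (l := l + j) (by linarith) x).hasSum.mul_left _
  convert h1 using 1
  rw [← Finset.HasAntidiagonal.sigmaAntidiagonalEquivProd.tsum_eq f]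
  have hf' : Summable fun p => f (Finset.HasAntidiagonal.sigmaAntidiagonalEquivProd p) :=
    Finset.HasAntidiagonal.sigmaAntidiagonalEquivProd.summable_iff.mpr hf
  rw [hf'.tsum_sigma' fun n => (hasSum_fintype _).summable]
  refine tsum_congr fun n => ?_
  rw [tsum_fintype, neg_sub, sub_eq_add_neg, add_pow, Finset.sum_div,
    ← Finset.Nat.sum_antidiagonal_eq_sum_range_succ_mk
      (f := fun p : ℕ × ℕ => c ^ p.1 * (-x) ^ p.2 * (n.choose p.1 : ℝ) /
        (n.factorial * Real.Gamma (l + n + 1))),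
    ← Finset.sum_coe_sort (Finset.HasAntidiagonal.antidiagonal n)]
  refine Finset.sum_congr rfl fun p _ => ?_
  obtain ⟨⟨j, k⟩, hp⟩ := p
  simp only [Finset.HasAntidiagonal.mem_antidiagonal] at hp
  subst hp
  simp only [Finset.HasAntidiagonal.sigmaAntidiagonalEquivProd_apply, f]
  have h3 := Gamma_add_nat_pos hl (j + k)
  have h5 : ((j + k).choose j : ℝ) * j.factorial * k.factorial = (j + k).factorial := by
    have := Nat.choose_mul_factorial_mul_factorial (Nat.le_add_right j k)
    rw [Nat.add_sub_cancel_left] at this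
    exact_mod_cast this
  rw [← h5]
  have h6 : ((j + k).choose j : ℝ) ≠ 0 := by
    exact_mod_cast (Nat.choose_pos (Nat.le_add_right j k)).ne'
  push_cast [← add_assoc] at h3 ⊢
  field_simp

lemma hasDerivAt_besselClifford {l : ℝ} (hl : -1/2 < l) (x : ℝ) :
    HasDerivAt (besselClifford l) (-besselClifford (l + 1) x) x := by
  let g' : ℕ → ℝ → ℝ := fun k y =>
    k * (-y) ^ (k - 1) * (-1) / ((k.factorial : ℝ) * Real.Gamma (l + k + 1))
  have hsucc (k : ℕ) (y : ℝ) : g' (k + 1) y =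
      -((-y) ^ k / ((k.factorial : ℝ) * Real.Gamma (l + 1 + k + 1))) := by
    have h3 := Gamma_add_nat_pos hl (k + 1)
    simp only [g', Nat.factorial_succ]
    push_cast at h3 ⊢
    rw [show l + 1 + (k : ℝ) + 1 = l + (k + 1) + 1 by ring]
    field_simp
  let u : ℕ → ℝ := fun k => k.casesOn 0 fun j =>
    (Real.Gamma (l + 1 + 1))⁻¹ * ((2 * (|x| + 1)) ^ j / j.factorial)
  have hu : Summable u := by
    rw [← summable_nat_add_iff 1]
    exact (Real.summable_pow_div_factorial _).mul_left _
  have h1 : HasDerivAt (besselClifford l) (∑' k, g' k x) x := by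
    refine hasDerivAt_tsum_of_isPreconnected (u := u) (t := Metric.ball 0 (|x| + 1)) (y₀ := x)
      hu Metric.isOpen_ball (convex_ball _ _).isPreconnected ?_ ?_ ?_
      (summable_besselClifford hl x) ?_
    · intro k y _
      exact ((hasDerivAt_neg y).pow k).div_const _
    · intro k y hy
      rw [mem_ball_zero_iff, Real.norm_eq_abs] at hy
      cases k with
      | zero => simp [g', u]
      | succ k =>
        rw [hsucc, norm_neg]
        refine (norm_besselClifford_term_le (by linarith) y k).trans ?_
        have : 0 < Real.Gamma (l + 1 + 1) := Real.Gamma_pos_of_pos (by linarith)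
        simp only [u]
        gcongr
    · simp
    · simp
  convert h1 using 1
  have hg : Summable fun k => g' k x := by
    rw [← summable_nat_add_iff 1]
    simp only [hsucc]
    exact (summable_besselClifford (by linarith) x).neg
  rw [hg.tsum_eq_zero_add]
  simp only [hsucc, tsum_neg]
  simp [g', besselClifford]

lemma continuous_besselClifford {l : ℝ} (hl : -1/2 < l) : Continuous (besselClifford l) :=
  continuous_iff_continuousAt.2 fun x => (hasDerivAt_besselClifford hl x).continuousAt

lemma besselClifford_recurrence {l : ℝ} (hl : -1/2 < l) (x : ℝ) :
    besselClifford l x = (l + 1) * besselClifford (l + 1) x - x * besselClifford (l + 2) x := by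
  have h0 := summable_besselClifford hl x
  have h1 := summable_besselClifford (l := l + 1) (by linarith) x
  unfold besselClifford
  rw [h0.tsum_eq_zero_add, h1.tsum_eq_zero_add, mul_add, ← tsum_mul_left, ← tsum_mul_left,
    add_sub_assoc, ← Summable.tsum_sub]
  · congr 1
    · have := Gamma_add_nat_pos hl 0
      have h2 := Real.Gamma_add_one (s := l + 1) (by linarith)
      simp only [Nat.cast_zero, add_zero] at *
      rw [h2]
      field_simp
      rw [div_self (by linarith)]
    · refine tsum_congr fun k => ?_
      have h3 := Gamma_add_nat_pos hl (k + 1)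
      have h2 := Real.Gamma_add_one (s := l + (k + 1 : ℕ) + 1)
        (by have : (0 : ℝ) ≤ (k + 1 : ℕ) := Nat.cast_nonneg _
            linarith)
      have hk : (0 : ℝ) ≤ k := k.cast_nonneg
      rw [show l + 1 + (k + 1 : ℕ) + 1 = l + (k + 1 : ℕ) + 1 + 1 by ring,
        show l + 2 + (k : ℝ) + 1 = l + (k + 1 : ℕ) + 1 + 1 by push_cast; ring, h2,
        Nat.factorial_succ]
      push_cast at h3 ⊢
      have h4 : l + (k + 1) + 1 ≠ 0 := by linarith
      field_simp
      ring
  · exact ((summable_nat_add_iff 1).2 h1).mul_left _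
  · exact (summable_besselClifford (l := l + 2) (by linarith) x).mul_left _

lemma exists_abs_besselClifford_le {l : ℝ} (hl : -1/2 < l) :
    ∃ C > 0, ∀ x > 0, |besselClifford l x| ≤ C * x ^ (-(l / 2 + 1 / 4)) := by
  obtain ⟨m, rfl⟩ : ∃ m, l = m - 1 / 2 := ⟨l + 1 / 2, by ring⟩
  have hm : 0 < m := by linarith
  let A := besselClifford (m - 1 / 2)
  let B := besselClifford (m - 1 / 2 + 1)
  let Q : ℝ → ℝ := fun x => A x ^ 2 + x * B x ^ 2 - m * (A x * B x)
  let W : ℝ → ℝ := fun x => x ^ m * Q x * Real.exp (m * x ^ (-(1 / 2) : ℝ))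
  have hx0 : 0 < m ^ 2 + 1 := by positivity
  have hsqrt : ∀ x, m ^ 2 + 1 ≤ x → 0 < x ∧ m ≤ √x ∧ √x ^ 2 = x := fun x hx => by
    have hx' : 0 < x := by linarith
    exact ⟨hx', Real.le_sqrt_of_sq_le (by linarith), Real.sq_sqrt hx'.le⟩
  have hAB : ∀ x, m ^ 2 + 1 ≤ x → 2 * √x * |A x * B x| ≤ A x ^ 2 + x * B x ^ 2 := fun x hx => by
    obtain ⟨h1, h2, h3⟩ := hsqrt x hx
    have := two_mul_le_add_sq |A x| (√x * |B x|)
    rw [mul_pow, h3, sq_abs, sq_abs] at this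
    rw [abs_mul]
    linarith
  have hQ : ∀ x, m ^ 2 + 1 ≤ x → A x ^ 2 ≤ 2 * Q x := fun x hx => by
    obtain ⟨h1, h2, h3⟩ := hsqrt x hx
    have h4 := hAB x hx
    have h5 : m * (A x * B x) ≤ √x * |A x * B x| := by
      calc m * (A x * B x) ≤ m * |A x * B x| := by gcongr; exact le_abs_self _
        _ ≤ _ := by gcongr
    have : 0 ≤ x * B x ^ 2 := by positivity
    simp only [Q]
    linarith
  have hW : AntitoneOn W (Ici (m ^ 2 + 1)) := by
    have hd : ∀ x, 0 < x → HasDerivAt W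
        (m / 2 * x ^ (m - 1) * Real.exp (m * x ^ (-(1 / 2) : ℝ)) * (A x * B x - Q x / √x)) x := by
      intro x hx
      have hA : HasDerivAt A (-B x) x := hasDerivAt_besselClifford hl x
      have hB : HasDerivAt B (-besselClifford (m - 1 / 2 + 2) x) x := by
        convert hasDerivAt_besselClifford (l := m - 1 / 2 + 1) (by linarith) x using 3
        ring
      have hQd := ((hA.pow 2).add ((hasDerivAt_id x).mul (hB.pow 2))).sub
        ((hA.mul hB).const_mul m)
      have hpow := Real.hasDerivAt_rpow_const (x := x) (p := m) (Or.inl hx.ne')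
      have hexp := ((Real.hasDerivAt_rpow_const (x := x) (p := -(1 / 2))
        (Or.inl hx.ne')).const_mul m).exp
      refine ((hpow.mul hQd).mul hexp).congr_deriv ?_
      have h1 : A x = _ := besselClifford_recurrence hl x
      have h2 : x * besselClifford (m - 1 / 2 + 2) x = (m - 1 / 2 + 1) * B x - A x := by
        rw [h1]; ring
      have h3 : x ^ m = x * x ^ (m - 1) := by
        rw [Real.rpow_sub_one hx.ne']; field_simp
      have h4 : x ^ (-(1 / 2) - 1 : ℝ) * x = (√x)⁻¹ := by
        rw [Real.rpow_sub_one hx.ne', Real.sqrt_eq_rpow, ← Real.rpow_neg hx.le]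
        field_simp
      simp only [Pi.add_apply, Pi.mul_apply, Pi.sub_apply, Pi.pow_apply, id, Q]
      rw [h3, div_eq_mul_inv _ √x, ← h4]
      generalize Real.exp _ = ex at *
      generalize x ^ (-(1 / 2) - 1 : ℝ) = r at *
      generalize x ^ (m - 1) = t at *
      generalize besselClifford (m - 1 / 2 + 2) x = D at *
      generalize B x = b at *
      generalize A x = a at *
      linear_combination (ex * t * (m * a - 2 * x * b)) * h2
    refine antitoneOn_of_deriv_nonpos (convex_Ici _) ?_ ?_ ?_
    · exact fun x hx => (hd x (hsqrt x hx).1).continuousAt.continuousWithinAt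
    · exact fun x hx =>
        (hd x (hsqrt x (interior_subset hx)).1).differentiableAt.differentiableWithinAt
    · intro x hx
      have hx' := interior_subset hx
      obtain ⟨h1, h2, h3⟩ := hsqrt x hx'
      rw [(hd x h1).deriv]
      refine mul_nonpos_of_nonneg_of_nonpos (by positivity) ?_
      rw [sub_nonpos, le_div_iff₀ (by linarith)]
      have h4 := hAB x hx'
      have h5 : (√x + m) * (A x * B x) ≤ 2 * √x * |A x * B x| := by
        calc (√x + m) * (A x * B x) ≤ (√x + m) * |A x * B x| := by
              gcongr; exact le_abs_self _
          _ ≤ _ := by gcongr; linarith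
      simp only [Q]
      linarith
  have hlarge : ∀ x, m ^ 2 + 1 ≤ x →
      |A x| ≤ √(2 * W (m ^ 2 + 1)) * x ^ (-(m / 2)) := by
    intro x hx
    have hx' := (hsqrt x hx).1
    have h1 : W x ≤ W (m ^ 2 + 1) := hW self_mem_Ici hx hx
    have hQ0 : 0 ≤ Q x := by have := hQ x hx; nlinarith [sq_nonneg (A x)]
    have h2 : x ^ m * Q x ≤ W x :=
      le_mul_of_one_le_right (by positivity) (Real.one_le_exp (by positivity))
    have h3 : x ^ m * A x ^ 2 ≤ 2 * W (m ^ 2 + 1) := by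
      calc x ^ m * A x ^ 2 ≤ x ^ m * (2 * Q x) := by gcongr; exact hQ x hx
        _ ≤ _ := by linarith
    have h4 : x ^ (m / 2) * |A x| ≤ √(2 * W (m ^ 2 + 1)) := by
      refine Real.le_sqrt_of_sq_le ?_
      rwa [mul_pow, sq_abs, ← Real.rpow_mul_natCast hx'.le, Nat.cast_ofNat,
        div_mul_cancel₀ m two_ne_zero]
    rw [Real.rpow_neg hx'.le, ← div_eq_mul_inv, le_div_iff₀ (by positivity), mul_comm]
    exact h4
  obtain ⟨M, hM⟩ := isCompact_Icc.exists_bound_of_continuousOn (s := Icc 0 (m ^ 2 + 1))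
    (continuous_besselClifford hl).continuousOn
  have hM0 : 0 ≤ M := (norm_nonneg _).trans (hM 0 ⟨le_rfl, hx0.le⟩)
  refine ⟨√(2 * W (m ^ 2 + 1)) + M * (m ^ 2 + 1) ^ (m / 2) + 1, by positivity, fun x hx => ?_⟩
  rw [show (m - 1 / 2) / 2 + 1 / 4 = m / 2 by ring]
  rcases le_total (m ^ 2 + 1) x with h | h
  · refine (hlarge x h).trans ?_
    gcongr
    have : 0 ≤ M * (m ^ 2 + 1) ^ (m / 2) := by positivity
    linarith
  · refine (hM x ⟨hx.le, h⟩).trans ?_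
    rw [Real.rpow_neg hx.le, ← div_eq_mul_inv, le_div_iff₀ (by positivity)]
    have h1 : M * x ^ (m / 2) ≤ M * (m ^ 2 + 1) ^ (m / 2) := by gcongr
    have := Real.sqrt_nonneg (2 * W (m ^ 2 + 1))
    linarith

lemma abs_besselClifford_succ_le {l C p : ℝ} (hl : -1/2 < l) (hp : 1/2 ≤ l + 1 - p)
    (h : ∀ x > 0, |besselClifford l x| ≤ C * x ^ (-p)) :
    ∀ x > 0, |besselClifford (l + 1) x| ≤ 2 * C * x ^ (-p) := by
  have hC : 0 ≤ C := by
    have := (abs_nonneg _).trans (h 1 one_pos)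
    simpa using this
  have key : ∀ e : ℝ, |e| = 1 → ∀ x > 0,
      e * (x ^ (l + 1) * besselClifford (l + 1) x) ≤ C / (l + 1 - p) * x ^ (l + 1 - p) := by
    intro e he x hx
    let H : ℝ → ℝ := fun x => C / (l + 1 - p) * x ^ (l + 1 - p) -
      e * (x ^ (l + 1) * besselClifford (l + 1) x)
    have hd : ∀ x > 0, HasDerivAt H
        (C / (l + 1 - p) * ((l + 1 - p) * x ^ (l + 1 - p - 1)) -
          e * ((l + 1) * x ^ (l + 1 - 1) * besselClifford (l + 1) x +
            x ^ (l + 1) * -besselClifford (l + 1 + 1) x)) x := fun x hx =>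
      ((Real.hasDerivAt_rpow_const (Or.inl hx.ne')).const_mul _).sub
        (((Real.hasDerivAt_rpow_const (Or.inl hx.ne')).mul
          (hasDerivAt_besselClifford (by linarith) x)).const_mul _)
    have hmono : MonotoneOn H (Ici 0) := by
      refine monotoneOn_of_deriv_nonneg (convex_Ici 0) ?_ ?_ ?_
      · refine Continuous.continuousOn ?_
        have := continuous_besselClifford (l := l + 1) (by linarith)
        have := Real.continuous_rpow_const (q := l + 1) (by linarith)
        have := Real.continuous_rpow_const (q := l + 1 - p) (by linarith)
        fun_prop
      · rw [interior_Ici]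
        exact fun x hx => (hd x hx).differentiableAt.differentiableWithinAt
      · rw [interior_Ici]
        intro x hx
        rw [(hd x hx).deriv]
        have hx : 0 < x := hx
        have h1 := besselClifford_recurrence hl x
        rw [show l + 1 + 1 = l + 2 by ring, show l + 1 - 1 = l by ring, Real.rpow_add_one hx.ne',
          show e * ((l + 1) * x ^ l * besselClifford (l + 1) x +
            x ^ l * x * -besselClifford (l + 2) x) = x ^ l * (e * besselClifford l x) by
              rw [h1]; ring]
        have h2 : e * besselClifford l x ≤ C * x ^ (-p) := by
          refine (le_abs_self _).trans ?_
          rw [abs_mul, he, one_mul]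
          exact h x hx
        have h3 : C / (l + 1 - p) * ((l + 1 - p) * x ^ (l + 1 - p - 1)) =
            x ^ l * (C * x ^ (-p)) := by
          rw [show l + 1 - p - 1 = l + -p by ring, Real.rpow_add hx]
          field_simp [show l + 1 - p ≠ 0 by linarith]
        rw [h3, sub_nonneg]
        gcongr
    have h0 := hmono (a := 0) self_mem_Ici hx.le hx.le
    simp only [H] at h0
    rw [Real.zero_rpow (by linarith), Real.zero_rpow (by linarith)] at h0
    linarith
  intro x hx
  have h1 : |x ^ (l + 1) * besselClifford (l + 1) x| ≤ C / (l + 1 - p) * x ^ (l + 1 - p) := by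
    rw [abs_le']
    exact ⟨by simpa using key 1 (by simp) x hx, by simpa using key (-1) (by simp) x hx⟩
  have h2 : C / (l + 1 - p) ≤ 2 * C := by
    rw [div_le_iff₀ (by linarith)]
    nlinarith
  have h3 : C / (l + 1 - p) * x ^ (l + 1 - p) ≤ 2 * C * x ^ (l + 1 - p) := by gcongr
  rw [abs_mul, abs_of_pos (by positivity)] at h1
  rw [sub_eq_add_neg (l + 1), Real.rpow_add hx (l + 1)] at h1 h3
  refine le_of_mul_le_mul_left ((h1.trans h3).trans_eq ?_) (Real.rpow_pos_of_pos hx (l + 1))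
  ring

lemma exists_abs_besselClifford_add_nat_le {l : ℝ} (hl : -1/2 < l) :
    ∃ C > 0, ∀ k : ℕ, ∀ x > 0,
      |besselClifford (l + k) x| ≤ 2 ^ k * C * x ^ (-(l / 2 + 1 / 4)) := by
  obtain ⟨C, hC, h⟩ := exists_abs_besselClifford_le hl
  refine ⟨C, hC, fun k => ?_⟩
  induction k with
  | zero => simpa using h
  | succ k ih =>
    have hk : (0 : ℝ) ≤ k := k.cast_nonneg
    have := abs_besselClifford_succ_le (l := l + k) (by linarith) (by linarith) ih
    simpa only [pow_succ', mul_assoc, Nat.cast_succ, add_assoc] using this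

lemma integrableOn_one_add_rpow_mul_rpow {a c : ℝ} (ha : 0 ≤ a) (hc : c < 1) (hac : 1 < a + c) :
    IntegrableOn (fun s : ℝ => (1 + s) ^ (-a) * s ^ (-c)) (Ioi 0) := by
  have hcont : ContinuousOn (fun s : ℝ => (1 + s) ^ (-a) * s ^ (-c)) (Ioi 0) := by
    refine ContinuousOn.mul ?_ ?_
    · exact ContinuousOn.rpow_const (by fun_prop) fun s hs =>
        Or.inl (by linarith [mem_Ioi.1 hs])
    · exact ContinuousOn.rpow_const (by fun_prop) fun s hs => Or.inl (ne_of_gt hs)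
  rw [← Ioc_union_Ioi_eq_Ioi zero_le_one]
  refine IntegrableOn.union ?_ ?_
  · have h1 : IntegrableOn (fun s : ℝ => s ^ (-c)) (Ioc 0 1) :=
      (intervalIntegral.intervalIntegrable_rpow' (by linarith)).1
    refine Integrable.mono' h1
      ((hcont.mono Ioc_subset_Ioi_self).aestronglyMeasurable measurableSet_Ioc) ?_
    refine (ae_restrict_mem measurableSet_Ioc).mono fun s hs => ?_
    have hs0 : 0 < s := hs.1
    rw [Real.norm_of_nonneg (by positivity)]
    exact mul_le_of_le_one_left (by positivity)
      (Real.rpow_le_one_of_one_le_of_nonpos (by linarith) (neg_nonpos.2 ha))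
  · have h1 : IntegrableOn (fun s : ℝ => s ^ (-a + -c)) (Ioi 1) :=
      integrableOn_Ioi_rpow_of_lt (by linarith) one_pos
    refine Integrable.mono' h1 ((hcont.mono (Ioi_subset_Ioi zero_le_one)).aestronglyMeasurable
      measurableSet_Ioi) ?_
    refine (ae_restrict_mem measurableSet_Ioi).mono fun s hs => ?_
    have hs0 : 0 < s := one_pos.trans hs
    rw [Real.norm_of_nonneg (by positivity), Real.rpow_add hs0]
    gcongr ?_ * _
    exact Real.rpow_le_rpow_of_nonpos hs0 (by linarith) (by linarith)

lemma integrableOn_rpow_mul_exp_neg_mul {a r : ℝ} (ha : -1 < a) (hr : 0 < r) :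
    IntegrableOn (fun s : ℝ => s ^ a * Real.exp (-(r * s))) (Ioi 0) := by
  simpa using integrableOn_rpow_mul_exp_neg_mul_rpow ha one_pos hr

/-- The Laplace transform of `s ^ l * besselClifford l (q * s)`. -/
lemma integral_besselClifford_mul_exp_neg {l q w : ℝ} (hl : -1/2 < l) (hw : 0 < w) :
    ∫ s in Ioi (0 : ℝ), s ^ l * besselClifford l (q * s) * Real.exp (-(w * s)) =
      w ^ (-l - 1) * Real.exp (-(q / w)) := by
  let f : ℕ → ℝ → ℝ := fun k s => (-q) ^ k / ((k.factorial : ℝ) * Real.Gamma (l + k + 1)) *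
    (s ^ (l + k) * Real.exp (-(w * s)))
  have hlk (k : ℕ) : -1 < l + k := by
    have : (0 : ℝ) ≤ k := k.cast_nonneg
    linarith
  have hint (k : ℕ) : ∫ s in Ioi (0 : ℝ), s ^ (l + k) * Real.exp (-(w * s)) =
      w ^ (-l - 1) * (w⁻¹ ^ k * Real.Gamma (l + k + 1)) := by
    have := Real.integral_rpow_mul_exp_neg_mul_Ioi (a := l + k + 1) (by linarith [hlk k]) hw
    rw [add_sub_cancel_right] at this
    rw [this, one_div, Real.inv_rpow hw.le, ← Real.rpow_neg hw.le,
      show -(l + k + 1 : ℝ) = -l - 1 + -k by ring, Real.rpow_add hw, Real.rpow_neg hw.le (k : ℝ),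
      Real.rpow_natCast, inv_pow, mul_assoc]
  have h1 (k : ℕ) : IntegrableOn (f k) (Ioi 0) :=
    (integrableOn_rpow_mul_exp_neg_mul (hlk k) hw).const_mul _
  have h2 (k : ℕ) : ∫ s in Ioi (0 : ℝ), ‖f k s‖ = w ^ (-l - 1) * ((|q| / w) ^ k / k.factorial) := by
    have hG := Gamma_add_nat_pos hl k
    have : ∫ s in Ioi (0 : ℝ), ‖f k s‖ = ∫ s in Ioi (0 : ℝ),
        |q| ^ k / ((k.factorial : ℝ) * Real.Gamma (l + k + 1)) *
          (s ^ (l + k) * Real.exp (-(w * s))) := by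
      refine setIntegral_congr_fun measurableSet_Ioi fun s hs => ?_
      have hs : 0 < s := hs
      simp only [f]
      rw [norm_mul, norm_div, norm_pow, norm_neg, Real.norm_eq_abs q,
        Real.norm_of_nonneg (r := (k.factorial : ℝ) * _) (by positivity),
        Real.norm_of_nonneg (by positivity)]
    rw [this, integral_const_mul, hint, div_pow, inv_pow]
    field_simp
  have h3 := hasSum_integral_of_summable_integral_norm h1 (by
    simp only [h2]
    exact (Real.summable_pow_div_factorial _).mul_left _)
  have h4 : HasSum (fun k => ∫ s in Ioi (0 : ℝ), f k s) (w ^ (-l - 1) * Real.exp (-(q / w))) := by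
    have h (k : ℕ) : ∫ s in Ioi (0 : ℝ), f k s =
        w ^ (-l - 1) * ((-(q / w)) ^ k / k.factorial) := by
      have hG := Gamma_add_nat_pos hl k
      simp only [f]
      rw [integral_const_mul, hint, ← neg_div, div_pow, inv_pow]
      field_simp
    simp only [h]
    rw [Real.exp_eq_exp_ℝ]
    exact (NormedSpace.expSeries_div_hasSum_exp (-(q / w))).mul_left _
  rw [← h3.unique h4]
  refine setIntegral_congr_fun measurableSet_Ioi fun s hs => ?_
  have hs : 0 < s := hs
  simp only [f, besselClifford]
  rw [← tsum_mul_left, ← tsum_mul_right]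
  refine tsum_congr fun k => ?_
  rw [Real.rpow_add_natCast hs.ne', ← neg_mul, mul_pow]
  ring

lemma integral_one_add_cpow_mul_besselClifford {l q : ℝ} {ν : ℂ} (hl : -1/2 < l)
    (hν : -1 < ν.re)
    (hint : IntegrableOn (fun s : ℝ => (1 + s) ^ (-(ν.re + 1)) * (s ^ l * besselClifford l (q * s)))
      (Ioi 0)) :
    Complex.Gamma (ν + 1) * ∫ s in Ioi (0 : ℝ), ((1 + s : ℝ) : ℂ) ^ (-(ν + 1)) *
      ((s ^ l * besselClifford l (q * s) : ℝ) : ℂ) =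
    ∫ w in Ioi (0 : ℝ), (w : ℂ) ^ (ν - l - 1) * Complex.exp (-(w + q / w)) := by
  let f : ℝ → ℝ → ℂ := fun s w => ((s ^ l * besselClifford l (q * s) : ℝ) : ℂ) *
    ((w : ℂ) ^ (ν + 1 - 1) * Complex.exp (-(((1 + s : ℝ) : ℂ) * w)))
  have hnorm (s : ℝ) {w : ℝ} (hw : 0 < w) : ‖f s w‖ = |s ^ l * besselClifford l (q * s)| *
      (w ^ (ν.re + 1 - 1) * Real.exp (-((1 + s) * w))) := by
    simp only [f]
    rw [norm_mul, norm_mul, Complex.norm_real, Complex.norm_cpow_eq_rpow_re_of_pos hw,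
      Complex.norm_exp, Real.norm_eq_abs]
    congr 3
    simp
  have hmeas : Measurable (Function.uncurry f) := by
    have := (continuous_besselClifford hl).measurable
    simp only [f, Function.uncurry_def]
    fun_prop
  have hinner (s : ℝ) (hs : 0 < s) : IntegrableOn (fun w => ‖f s w‖) (Ioi 0) := by
    have h : IntegrableOn (fun w => |s ^ l * besselClifford l (q * s)| *
      (w ^ (ν.re + 1 - 1) * Real.exp (-((1 + s) * w)))) (Ioi 0) :=
      (integrableOn_rpow_mul_exp_neg_mul (by linarith) (by linarith)).const_mul _
    exact h.congr_fun (fun w hw => (hnorm s hw).symm) measurableSet_Ioi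
  have hprod : Integrable (Function.uncurry f)
      ((volume.restrict (Ioi 0)).prod (volume.restrict (Ioi 0))) := by
    rw [integrable_prod_iff hmeas.aestronglyMeasurable]
    refine ⟨(ae_restrict_mem measurableSet_Ioi).mono fun s hs => ?_, ?_⟩
    · refine (integrable_norm_iff ?_).1 (hinner s hs)
      exact (hmeas.comp measurable_prodMk_left).aestronglyMeasurable
    · refine IntegrableOn.congr_fun (hint.norm.mul_const (Real.Gamma (ν.re + 1)))
        (fun s hs => ?_) measurableSet_Ioi
      have hs : 0 < s := hs
      have h1 : ∫ w in Ioi (0 : ℝ), ‖f s w‖ = ∫ w in Ioi (0 : ℝ),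
          |s ^ l * besselClifford l (q * s)| *
            (w ^ (ν.re + 1 - 1) * Real.exp (-((1 + s) * w))) :=
        setIntegral_congr_fun measurableSet_Ioi fun w hw => hnorm s hw
      simp only [Function.uncurry_apply_pair]
      rw [h1, integral_const_mul, Real.integral_rpow_mul_exp_neg_mul_Ioi (by linarith)
        (by linarith), norm_mul, Real.norm_of_nonneg (by positivity), Real.norm_eq_abs, one_div,
        Real.inv_rpow (by linarith), ← Real.rpow_neg (by linarith)]
      ring
  have hswap := integral_integral_swap hprod
  have hL : ∫ s in Ioi (0 : ℝ), ∫ w in Ioi (0 : ℝ), f s w =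
      Complex.Gamma (ν + 1) * ∫ s in Ioi (0 : ℝ), ((1 + s : ℝ) : ℂ) ^ (-(ν + 1)) *
        ((s ^ l * besselClifford l (q * s) : ℝ) : ℂ) := by
    rw [← integral_const_mul]
    refine setIntegral_congr_fun measurableSet_Ioi fun s hs => ?_
    have hs : 0 < 1 + s := by linarith [mem_Ioi.1 hs]
    simp only [f]
    rw [integral_const_mul, Complex.integral_cpow_mul_exp_neg_mul_Ioi (by simp; linarith) hs,
      one_div, Complex.inv_cpow _ _ (by
        rw [Complex.arg_ofReal_of_nonneg hs.le]; exact Real.pi_pos.ne), ← Complex.cpow_neg]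
    ring
  rw [← hL, hswap]
  refine setIntegral_congr_fun measurableSet_Ioi fun w hw => ?_
  have hw : 0 < w := hw
  have h1 (s : ℝ) : f s w = (w : ℂ) ^ ν * Complex.exp (-w) *
      ((s ^ l * besselClifford l (q * s) * Real.exp (-(w * s)) : ℝ) : ℂ) := by
    simp only [f]
    rw [add_sub_cancel_right, show -(((1 + s : ℝ) : ℂ) * w) = -w + -(w * s) by push_cast; ring,
      Complex.exp_add]
    push_cast
    ring
  simp only [h1]
  rw [integral_const_mul, integral_complex_ofReal, integral_besselClifford_mul_exp_neg hl hw,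
    neg_add, Complex.exp_add, show ν - l - 1 = ν + ((-l - 1 : ℝ) : ℂ) by push_cast; ring,
    Complex.cpow_add _ _ (by exact_mod_cast hw.ne'), Complex.ofReal_mul,
    Complex.ofReal_cpow hw.le]
  push_cast
  ring

lemma integrable_exp_neg_mul_cosh_mul_exp {x : ℝ} (hx : 0 < x) (μ : ℂ) :
    Integrable fun t : ℝ => Complex.exp (-(x : ℂ) * Real.cosh t) * Complex.exp (μ * t) := by
  have hg : Integrable fun t : ℝ => Real.exp (μ.re ^ 2 / x) * Real.exp (-(x / 4) * t ^ 2) :=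
    (integrable_exp_neg_mul_sq (by positivity)).const_mul _
  refine hg.mono' (by fun_prop) (ae_of_all _ fun t => ?_)
  have h1 : 1 + t ^ 2 / 2 ≤ Real.cosh t := by
    have h2 := Real.cosh_sq (t / 2)
    have h3 := Real.cosh_two_mul (t / 2)
    have h4 : (t / 2) ^ 2 ≤ Real.sinh (t / 2) ^ 2 := by
      rw [sq_le_sq, Real.abs_sinh]
      exact Real.self_le_sinh_iff.2 (abs_nonneg _)
    rw [mul_div_cancel₀ t two_ne_zero] at h3
    linarith
  rw [norm_mul, Complex.norm_exp, Complex.norm_exp, ← Real.exp_add, ← Real.exp_add]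
  refine Real.exp_le_exp.2 ?_
  have h5 : (-(x : ℂ) * Real.cosh t).re = -(x * Real.cosh t) := by
    rw [← Complex.ofReal_neg, ← Complex.ofReal_mul, Complex.ofReal_re, neg_mul]
  have h6 : (μ * t).re = μ.re * t := by simp
  have h7 : μ.re * t ≤ μ.re ^ 2 / x + x / 4 * t ^ 2 := by
    have : μ.re ^ 2 / x + x / 4 * t ^ 2 - μ.re * t = (μ.re - x / 2 * t) ^ 2 / x := by
      field_simp
      ring
    have : 0 ≤ (μ.re - x / 2 * t) ^ 2 / x := by positivity
    linarith
  have h8 := mul_le_mul_of_nonneg_left h1 hx.le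
  rw [h5, h6]
  linarith

lemma two_mul_besselK {x : ℝ} (hx : 0 < x) (μ : ℂ) :
    2 * besselK μ x =
      ∫ t : ℝ, Complex.exp (-(x : ℂ) * Real.cosh t) * Complex.exp (-μ * t) := by
  have h := integrable_exp_neg_mul_cosh_mul_exp hx (-μ)
  have h' := integrable_exp_neg_mul_cosh_mul_exp hx μ
  rw [← intervalIntegral.integral_Iic_add_Ioi (b := 0) h.integrableOn h.integrableOn, ← neg_zero,
    ← integral_comp_neg_Ioi, neg_zero]
  simp only [Real.cosh_neg, Complex.ofReal_neg, neg_mul_neg]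
  rw [← integral_add h'.integrableOn h.integrableOn, besselK, ← integral_const_mul]
  refine setIntegral_congr_fun measurableSet_Ioi fun t _ => ?_
  simp only [Complex.cosh, neg_mul]
  ring

lemma integral_cpow_mul_exp_eq_besselK {b : ℝ} (hb : 0 < b) (μ : ℂ) :
    ∫ w in Ioi (0 : ℝ), (w : ℂ) ^ (-μ - 1) * Complex.exp (-(w + (b ^ 2 : ℝ) / w)) =
      2 * besselK μ (2 * b) * (b : ℂ) ^ (-μ) := by
  have himage : (fun t : ℝ => b * Real.exp t) '' univ = Ioi 0 := by
    ext w
    simp only [image_univ, mem_range, mem_Ioi]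
    exact ⟨fun ⟨t, ht⟩ => ht ▸ by positivity,
      fun hw => ⟨Real.log (w / b), by rw [Real.exp_log (by positivity)]; field_simp⟩⟩
  rw [← himage, integral_image_eq_integral_abs_deriv_smul MeasurableSet.univ
    (f' := fun t => b * Real.exp t)
    (fun t _ => ((Real.hasDerivAt_exp t).const_mul b).hasDerivWithinAt)
    (fun s _ t _ hst => Real.exp_injective (mul_left_cancel₀ hb.ne' hst)),
    two_mul_besselK (by positivity), Measure.restrict_univ, ← integral_mul_const]
  refine integral_congr_ae (ae_of_all _ fun t => ?_)
  have hbt : 0 < b * Real.exp t := by positivity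
  have hbC : (b : ℂ) ≠ 0 := by exact_mod_cast hb.ne'
  have h1 : (((b * Real.exp t : ℝ) : ℂ)) ≠ 0 := by exact_mod_cast hbt.ne'
  have h2 : (((b * Real.exp t : ℝ) : ℂ)) ^ (-μ) = (b : ℂ) ^ (-μ) * Complex.exp (-μ * t) := by
    rw [Complex.ofReal_mul, Complex.mul_cpow_ofReal_nonneg hb.le (Real.exp_pos t).le,
      Complex.cpow_def_of_ne_zero (x := (Real.exp t : ℂ)) (by exact_mod_cast (Real.exp_pos t).ne'),
      ← Complex.ofReal_log (Real.exp_pos t).le, Real.log_exp, mul_comm (t : ℂ)]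
  have h3 : ((b * Real.exp t : ℝ) : ℂ) + (b ^ 2 : ℝ) / ((b * Real.exp t : ℝ) : ℂ) =
      ((2 * b : ℝ) : ℂ) * Real.cosh t := by
    norm_cast
    rw [Real.cosh_eq, Real.exp_neg]
    field_simp
  simp only
  rw [abs_of_pos hbt, Complex.cpow_sub _ _ h1, Complex.cpow_one, h2, h3, Complex.real_smul]
  field_simp

/-- The kernel in the integral representation of the `k`-th term of `K_μ I_ν`. -/
noncomputable def besselProductTerm (α b : ℝ) (ν : ℂ) (k : ℕ) (s : ℝ) : ℂ :=
  ((1 + s : ℝ) : ℂ) ^ (-(ν + k + 1)) *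
    ((s ^ (2 * α + k) * besselClifford (2 * α + k) (b ^ 2 * s) : ℝ) : ℂ)

lemma norm_besselProductTerm (α b : ℝ) (ν : ℂ) (k : ℕ) {s : ℝ} (hs : 0 < s) :
    ‖besselProductTerm α b ν k s‖ = (1 + s) ^ (-(ν.re + k + 1)) *
      |s ^ (2 * α + k) * besselClifford (2 * α + k) (b ^ 2 * s)| := by
  rw [besselProductTerm, norm_mul, Complex.norm_cpow_eq_rpow_re_of_pos (by linarith),
    Complex.norm_real, Real.norm_eq_abs]
  simp

lemma measurable_besselProductTerm {α : ℝ} (hα : -1/4 < α) (b : ℝ) (ν : ℂ) (k : ℕ) :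
    Measurable (besselProductTerm α b ν k) := by
  have hl : -1/2 < 2 * α + k := by
    have : (0 : ℝ) ≤ k := k.cast_nonneg
    linarith
  have := (continuous_besselClifford hl).measurable
  unfold besselProductTerm
  fun_prop

lemma exists_norm_besselProductTerm_le {α b : ℝ} (hα : -1/4 < α) (hb : 0 < b) :
    ∃ C, ∀ (ν : ℂ) (_ : ν.re = α) (k : ℕ) (s : ℝ), 0 < s → ‖besselProductTerm α b ν k s‖ ≤
      2 ^ k * C * ((1 + s) ^ (-(α + 1)) * s ^ (-(1 / 4 - α))) := by
  obtain ⟨C, hC, hF⟩ := exists_abs_besselClifford_add_nat_le (l := 2 * α) (by linarith)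
  rw [show 2 * α / 2 + 1 / 4 = α + 1 / 4 by ring] at hF
  refine ⟨C * (b ^ 2) ^ (-(α + 1 / 4)), fun ν hν k s hs => ?_⟩
  have h1 := hF k (b ^ 2 * s) (by positivity)
  have hs1 : 0 < 1 + s := by linarith
  rw [norm_besselProductTerm α b ν k hs, hν, abs_mul, abs_of_pos (Real.rpow_pos_of_pos hs _)]
  calc (1 + s) ^ (-(α + k + 1)) * (s ^ (2 * α + k) * |besselClifford (2 * α + k) (b ^ 2 * s)|)
      ≤ (1 + s) ^ (-(α + k + 1)) *
        (s ^ (2 * α + k) * (2 ^ k * C * (b ^ 2 * s) ^ (-(α + 1 / 4)))) := by gcongr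
    _ = (s / (1 + s)) ^ k * (2 ^ k * C * (b ^ 2) ^ (-(α + 1 / 4)) *
        ((1 + s) ^ (-(α + 1)) * (s ^ (2 * α) * s ^ (-(α + 1 / 4))))) := by
      rw [Real.mul_rpow (by positivity) hs.le, Real.rpow_add_natCast hs.ne',
        show -(α + k + 1) = -(α + 1) - k by ring, Real.rpow_sub_natCast hs1.ne', div_pow]
      ring
    _ ≤ 1 * (2 ^ k * C * (b ^ 2) ^ (-(α + 1 / 4)) *
        ((1 + s) ^ (-(α + 1)) * (s ^ (2 * α) * s ^ (-(α + 1 / 4))))) := by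
      gcongr
      exact pow_le_one₀ (by positivity) ((div_le_one hs1).2 (by linarith))
    _ = _ := by
      rw [← Real.rpow_add hs, one_mul, show 2 * α + -(α + 1 / 4) = -(1 / 4 - α) by ring]
      ring

lemma integrableOn_besselProductTerm {α b : ℝ} (hα : -1/4 < α) (hb : 0 < b) {ν : ℂ}
    (hν : ν.re = α) (k : ℕ) : IntegrableOn (besselProductTerm α b ν k) (Ioi 0) := by
  obtain ⟨C, hC⟩ := exists_norm_besselProductTerm_le hα hb
  exact ((integrableOn_one_add_rpow_mul_rpow (by linarith) (by linarith)
    (by linarith)).const_mul _).mono' (measurable_besselProductTerm hα b ν k).aestronglyMeasurable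
      ((ae_restrict_mem measurableSet_Ioi).mono (hC ν hν k))

lemma Gamma_mul_integral_besselProductTerm {α b : ℝ} (hα : -1/4 < α) (hb : 0 < b) (τ : ℝ) (k : ℕ) :
    Complex.Gamma (α - τ * Complex.I + k + 1) *
      ∫ s in Ioi (0 : ℝ), besselProductTerm α b (α - τ * Complex.I) k s =
      2 * besselK (α + τ * Complex.I) (2 * b) * (b : ℂ) ^ (-(α + τ * Complex.I : ℂ)) := by
  have hν : (α - τ * Complex.I : ℂ).re = α := by simp
  have hre : (α - τ * Complex.I + k : ℂ).re = α + k := by simp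
  have hk : (0 : ℝ) ≤ k := k.cast_nonneg
  have hl : -1/2 < 2 * α + k := by linarith
  have hint : IntegrableOn (fun s : ℝ => (1 + s) ^ (-((α - τ * Complex.I + k : ℂ).re + 1)) *
      (s ^ (2 * α + k) * besselClifford (2 * α + k) (b ^ 2 * s))) (Ioi 0) := by
    refine (integrable_norm_iff ?_).1 (IntegrableOn.congr_fun
      (integrableOn_besselProductTerm hα hb hν k).norm (fun s hs => ?_) measurableSet_Ioi)
    · have := (continuous_besselClifford hl).measurable
      exact Measurable.aestronglyMeasurable (by fun_prop)
    · have hs : 0 < s := hs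
      rw [norm_besselProductTerm α b _ k hs, hre, hν, norm_mul,
        Real.norm_of_nonneg (by positivity), Real.norm_eq_abs]
  have h := integral_one_add_cpow_mul_besselClifford hl (by rw [hre]; linarith) hint
  have he : (α - τ * Complex.I + k - ((2 * α + k : ℝ) : ℂ) - 1 : ℂ) =
      -(α + τ * Complex.I) - 1 := by
    push_cast
    ring
  rw [he, integral_cpow_mul_exp_eq_besselK hb] at h
  exact h

lemma hasSum_integral_besselProductTerm {α b : ℝ} (hα : -1/4 < α) (hb : 0 < b) {ν : ℂ}
    (hν : ν.re = α) :
    HasSum (fun k : ℕ => (((b ^ 2) ^ k / k.factorial : ℝ) : ℂ) *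
        ∫ s in Ioi (0 : ℝ), besselProductTerm α b ν k s)
      (∫ s in Ioi (0 : ℝ), ∑' k : ℕ,
        (((b ^ 2) ^ k / k.factorial : ℝ) : ℂ) * besselProductTerm α b ν k s) := by
  obtain ⟨C, hC⟩ := exists_norm_besselProductTerm_le hα hb
  have hD : IntegrableOn (fun s : ℝ => (1 + s) ^ (-(α + 1)) * s ^ (-(1 / 4 - α))) (Ioi 0) :=
    integrableOn_one_add_rpow_mul_rpow (by linarith) (by linarith) (by linarith)
  have hint (k : ℕ) := (integrableOn_besselProductTerm hα hb hν k).const_mul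
    (((b ^ 2) ^ k / k.factorial : ℝ) : ℂ)
  have hle (k : ℕ) : ∫ s in Ioi (0 : ℝ),
      ‖(((b ^ 2) ^ k / k.factorial : ℝ) : ℂ) * besselProductTerm α b ν k s‖ ≤
      (2 * b ^ 2) ^ k / k.factorial *
        (C * ∫ s in Ioi (0 : ℝ), (1 + s) ^ (-(α + 1)) * s ^ (-(1 / 4 - α))) := by
    rw [← mul_assoc, ← integral_const_mul]
    refine setIntegral_mono_on (hint k).norm (hD.const_mul _) measurableSet_Ioi fun s hs => ?_
    rw [norm_mul, Complex.norm_real, Real.norm_of_nonneg (by positivity)]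
    calc _ ≤ (b ^ 2) ^ k / k.factorial *
          (2 ^ k * C * ((1 + s) ^ (-(α + 1)) * s ^ (-(1 / 4 - α)))) := by
          gcongr
          exact hC ν hν k s hs
      _ = _ := by
        rw [mul_pow]
        ring
  have h := hasSum_integral_of_summable_integral_norm hint
    (Summable.of_nonneg_of_le (fun k => integral_nonneg fun s => norm_nonneg _) hle
      ((Real.summable_pow_div_factorial _).mul_right _))
  simpa only [integral_const_mul] using h

lemma tsum_besselProductTerm {α b : ℝ} (hα : -1/4 < α) (ν : ℂ) {s : ℝ} (hs : 0 < s) :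
    ∑' k : ℕ, (((b ^ 2) ^ k / k.factorial : ℝ) : ℂ) * besselProductTerm α b ν k s =
      ((1 + s : ℝ) : ℂ) ^ (-(ν + 1)) *
        ((s ^ (2 * α) * besselClifford (2 * α) (b ^ 2 * (s ^ 2 / (1 + s))) : ℝ) : ℂ) := by
  have hs1 : 0 < 1 + s := by linarith
  have hs1C : ((1 + s : ℝ) : ℂ) ≠ 0 := by exact_mod_cast hs1.ne'
  have hT := hasSum_besselClifford_taylor (l := 2 * α) (by linarith) (b ^ 2 * s)
    (b ^ 2 * s / (1 + s))
  rw [show b ^ 2 * s - b ^ 2 * s / (1 + s) = b ^ 2 * (s ^ 2 / (1 + s)) by field_simp; ring] at hT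
  rw [Complex.ofReal_mul, ← hT.tsum_eq, Complex.ofReal_tsum, ← mul_assoc, ← tsum_mul_left]
  refine tsum_congr fun k => ?_
  rw [besselProductTerm, Real.rpow_add_natCast hs.ne', show -(ν + k + 1) = -(ν + 1) - k by ring,
    Complex.cpow_sub _ _ hs1C, Complex.cpow_natCast]
  generalize ((1 + s : ℝ) : ℂ) ^ (-(ν + 1)) = A
  push_cast at hs1C ⊢
  rw [div_pow, mul_pow]
  field_simp

lemma besselK_mul_besselI {α b : ℝ} (hα : -1/4 < α) (hb : 0 < b) (τ : ℝ) :
    besselK (α + τ * Complex.I) (2 * b) * besselI (α - τ * Complex.I) (2 * b) =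
      ((b ^ (2 * α) / 2 : ℝ) : ℂ) * ∫ s in Ioi (0 : ℝ),
        ((1 + s : ℝ) : ℂ) ^ (-((α - τ * Complex.I : ℂ) + 1)) *
          ((s ^ (2 * α) * besselClifford (2 * α) (b ^ 2 * (s ^ 2 / (1 + s))) : ℝ) : ℂ) := by
  have hν : (α - τ * Complex.I : ℂ).re = α := by simp
  have hbC : (b : ℂ) ≠ 0 := by exact_mod_cast hb.ne'
  have hterm (k : ℕ) : besselK (α + τ * Complex.I) (2 * b) *
      ((((2 * b : ℝ) : ℂ) / 2) ^ (α - τ * Complex.I + 2 * (k : ℂ)) /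
        ((k.factorial : ℂ) * Complex.Gamma (α - τ * Complex.I + k + 1))) =
      ((b ^ (2 * α) / 2 : ℝ) : ℂ) * ((((b ^ 2) ^ k / k.factorial : ℝ) : ℂ) *
        ∫ s in Ioi (0 : ℝ), besselProductTerm α b (α - τ * Complex.I) k s) := by
    have hG : Complex.Gamma (α - τ * Complex.I + k + 1) ≠ 0 :=
      Complex.Gamma_ne_zero_of_re_pos (by
        have hk : (0 : ℝ) ≤ k := k.cast_nonneg
        rw [Complex.add_re, Complex.add_re, hν, Complex.natCast_re, Complex.one_re]
        linarith)
    have hk : (k.factorial : ℂ) ≠ 0 := by exact_mod_cast k.factorial_ne_zero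
    have h1 : (b : ℂ) ^ (α - τ * Complex.I + 2 * (k : ℂ)) =
        (b : ℂ) ^ ((2 * α : ℝ) : ℂ) * (b : ℂ) ^ (-(α + τ * Complex.I : ℂ)) *
        ((b : ℂ) ^ 2) ^ k := by
      rw [← Complex.cpow_add _ _ hbC, ← pow_mul, ← Complex.cpow_natCast,
        ← Complex.cpow_add _ _ hbC]
      congr 1
      push_cast
      ring
    have h2 := eq_div_of_mul_eq hG
      ((mul_comm _ _).trans (Gamma_mul_integral_besselProductTerm hα hb τ k))
    rw [h2, show ((2 * b : ℝ) : ℂ) / 2 = b by push_cast; ring, h1,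
      Complex.ofReal_div, Complex.ofReal_cpow hb.le]
    generalize (b : ℂ) ^ ((2 * α : ℝ) : ℂ) = A
    generalize (b : ℂ) ^ (-(α + τ * Complex.I : ℂ)) = B
    push_cast
    field_simp
  rw [besselI, ← tsum_mul_left]
  simp only [hterm]
  rw [tsum_mul_left, (hasSum_integral_besselProductTerm hα hb hν).tsum_eq]
  congr 1
  exact setIntegral_congr_fun measurableSet_Ioi fun s hs => tsum_besselProductTerm hα _ hs

/-- The integrand in an integral representation of
`q ^ (1/4) * K_{α+iτ}(2√q) * I_{α-iτ}(2√q)`. -/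
noncomputable def besselProductKernel (α q τ s : ℝ) : ℂ :=
  ((1 + s : ℝ) : ℂ) ^ (-((α - τ * Complex.I : ℂ) + 1)) *
    ((q ^ (α + 1 / 4) / 2 *
      (s ^ (2 * α) * besselClifford (2 * α) (q * (s ^ 2 / (1 + s)))) : ℝ) : ℂ)

lemma besselK_mul_besselI_eq_integral {α q : ℝ} (hα : -1/4 < α) (hq : 0 < q) (τ : ℝ) :
    ((q ^ (1 / 4 : ℝ) : ℝ) : ℂ) *
      (besselK (α + τ * Complex.I) (2 * √q) * besselI (α - τ * Complex.I) (2 * √q)) =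
    ∫ s in Ioi (0 : ℝ), besselProductKernel α q τ s := by
  rw [besselK_mul_besselI hα (Real.sqrt_pos.2 hq), ← mul_assoc, ← integral_const_mul]
  refine integral_congr_ae (ae_of_all _ fun s => ?_)
  have : q ^ (α + 1 / 4) = q ^ (1 / 4 : ℝ) * √q ^ (2 * α) := by
    rw [Real.sqrt_eq_rpow, ← Real.rpow_mul hq.le, ← Real.rpow_add hq]
    ring_nf
  simp only [besselProductKernel, this, Real.sq_sqrt hq.le]
  push_cast
  ring

lemma exists_norm_besselProductKernel_le {α : ℝ} (hα : -1/4 < α) :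
    ∃ C > 0, ∀ q > 0, ∀ τ : ℝ, ∀ s > 0, ‖besselProductKernel α q τ s‖ ≤
      C * ((1 + s) ^ (-(3 / 4) : ℝ) * s ^ (-(1 / 2) : ℝ)) := by
  obtain ⟨C, hC, hF⟩ := exists_abs_besselClifford_le (l := 2 * α) (by linarith)
  rw [show 2 * α / 2 + 1 / 4 = α + 1 / 4 by ring] at hF
  refine ⟨C / 2, by positivity, fun q hq τ s hs => ?_⟩
  have hs1 : 0 < 1 + s := by linarith
  have h1 := hF (q * (s ^ 2 / (1 + s))) (by positivity)
  rw [besselProductKernel, norm_mul, Complex.norm_cpow_eq_rpow_re_of_pos hs1, Complex.norm_real,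
    norm_mul, norm_mul, Real.norm_of_nonneg (by positivity), Real.norm_of_nonneg (by positivity),
    Real.norm_eq_abs]
  have hre : (-((α - τ * Complex.I : ℂ) + 1)).re = -(α + 1) := by simp
  rw [hre]
  calc _ ≤ (1 + s) ^ (-(α + 1)) * (q ^ (α + 1 / 4) / 2 * (s ^ (2 * α) *
        (C * (q * (s ^ 2 / (1 + s))) ^ (-(α + 1 / 4))))) := by gcongr
    _ = C / 2 * (q ^ (α + 1 / 4) * q ^ (-(α + 1 / 4))) *
        (((1 + s) ^ (-(α + 1)) * (1 + s) ^ (α + 1 / 4)) *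
          (s ^ (2 * α) * s ^ (2 * -(α + 1 / 4)))) := by
      rw [Real.mul_rpow hq.le (by positivity), Real.div_rpow (by positivity) hs1.le,
        ← Real.rpow_natCast s 2, ← Real.rpow_mul hs.le, Real.rpow_neg hs1.le (α + 1 / 4)]
      push_cast
      field_simp
    _ = _ := by
      rw [← Real.rpow_add hq, ← Real.rpow_add hs1, ← Real.rpow_add hs, add_neg_cancel,
        Real.rpow_zero, mul_one]
      ring_nf

lemma measurable_besselProductKernel {α : ℝ} (hα : -1/4 < α) (q τ : ℝ) :
    Measurable (besselProductKernel α q τ) := by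
  have := (continuous_besselClifford (l := 2 * α) (by linarith)).measurable
  unfold besselProductKernel
  fun_prop

lemma integrableOn_one_add_rpow_mul_rpow_neg_half :
    IntegrableOn (fun s : ℝ => (1 + s) ^ (-(3 / 4) : ℝ) * s ^ (-(1 / 2) : ℝ)) (Ioi 0) :=
  integrableOn_one_add_rpow_mul_rpow (by norm_num) (by norm_num) (by norm_num)

lemma continuousOn_integral_besselProductKernel {α : ℝ} (hα : -1/4 < α) (τ : ℝ) :
    ContinuousOn (fun q => ∫ s in Ioi (0 : ℝ), besselProductKernel α q τ s) (Ioi 0) := by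
  obtain ⟨C, hC, h⟩ := exists_norm_besselProductKernel_le hα
  refine continuousOn_of_dominated
    (fun q _ => (measurable_besselProductKernel hα q τ).aestronglyMeasurable)
    (fun q hq => (ae_restrict_mem measurableSet_Ioi).mono fun s hs => h q hq τ s hs)
    (integrableOn_one_add_rpow_mul_rpow_neg_half.const_mul C) (ae_of_all _ fun s => ?_)
  have := continuous_besselClifford (l := 2 * α) (by linarith)
  unfold besselProductKernel
  refine continuousOn_const.mul (Complex.continuous_ofReal.comp_continuousOn ?_)
  refine ContinuousOn.mul ?_ (by fun_prop)
  exact (ContinuousOn.rpow_const continuousOn_id fun q hq => Or.inl (ne_of_gt hq)).div_const _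

lemma continuous_integral_besselProductKernel {α q : ℝ} (hα : -1/4 < α) (hq : 0 < q) :
    Continuous fun τ => ∫ s in Ioi (0 : ℝ), besselProductKernel α q τ s := by
  obtain ⟨C, hC, h⟩ := exists_norm_besselProductKernel_le hα
  refine continuous_of_dominated
    (fun τ => (measurable_besselProductKernel hα q τ).aestronglyMeasurable)
    (fun τ => (ae_restrict_mem measurableSet_Ioi).mono fun s hs => h q hq τ s hs)
    (integrableOn_one_add_rpow_mul_rpow_neg_half.const_mul C)
    ((ae_restrict_mem measurableSet_Ioi).mono fun s hs => ?_)
  have hs1 : ((1 + s : ℝ) : ℂ) ≠ 0 := by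
    exact_mod_cast (show 0 < 1 + s by linarith [mem_Ioi.1 hs]).ne'
  unfold besselProductKernel
  exact (Continuous.const_cpow (by fun_prop) (Or.inl hs1)).mul continuous_const

lemma rpow_mul_Gtrans {α x : ℝ} (hα : -1/4 < α) (hx : 0 < x) (g : ℝ → ℝ) :
    x ^ ((1 : ℝ) / 4) * Gtrans α g x = 2 * √Real.pi * 4 ^ ((1 : ℝ) / 4) *
      ∫ τ : ℝ, (∫ s in Ioi (0 : ℝ), besselProductKernel α (x / 4) τ s).re * g τ /
        Real.cosh (Real.pi * τ) := by
  have hsqrt : √x = 2 * √(x / 4) := by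
    rw [Real.sqrt_div hx.le, show (4 : ℝ) = 2 ^ 2 by norm_num, Real.sqrt_sq zero_le_two]
    ring
  have hpow : x ^ ((1 : ℝ) / 4) = 4 ^ ((1 : ℝ) / 4) * (x / 4) ^ ((1 : ℝ) / 4) := by
    rw [← Real.mul_rpow (by norm_num) (by positivity), mul_div_cancel₀ x four_ne_zero]
  simp only [← besselK_mul_besselI_eq_integral hα (show 0 < x / 4 by positivity),
    Complex.re_ofReal_mul, mul_assoc, mul_div_assoc, integral_const_mul]
  rw [Gtrans, ← hsqrt, hpow]
  simp only [mul_assoc, mul_div_assoc]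
  ring

/-- Theorem 3, first part: for `α > −1/4` and
`g ∈ L₁(ℝ; [cosh(πτ)]⁻¹ dτ)`, the function `x^{1/4}(G_α g)(x)` is bounded and
continuous on `(0,∞)`, with
`sup_{x>0} x^{1/4}|(G_α g)(x)| ≤ C‖g‖_{L₁(ℝ;[cosh(πτ)]⁻¹dτ)}`. -/
theorem statement4 (α : ℝ) (hα : α > -1/4) :
    ∃ C > 0, ∀ g : ℝ → ℝ,
      MeasureTheory.AEStronglyMeasurable g MeasureTheory.volume →
      MeasureTheory.Integrable (fun τ : ℝ => |g τ| / Real.cosh (Real.pi * τ)) →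
      ContinuousOn (fun x : ℝ => x ^ ((1 : ℝ)/4) * Gtrans α g x) (Set.Ioi 0) ∧
      ∀ x : ℝ, 0 < x →
        x ^ ((1 : ℝ)/4) * |Gtrans α g x| ≤
          C * ∫ τ : ℝ, |g τ| / Real.cosh (Real.pi * τ) := by
  obtain ⟨C, hC, hk⟩ := exists_norm_besselProductKernel_le (α := α) (by linarith)
  set J : ℝ := ∫ s in Ioi (0 : ℝ), C * ((1 + s) ^ (-(3 / 4) : ℝ) * s ^ (-(1 / 2) : ℝ)) with hJ
  have hJ0 : 0 ≤ J := setIntegral_nonneg measurableSet_Ioi fun s hs => by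
    have hs : 0 < s := hs
    positivity
  let A : ℝ := 2 * √Real.pi * 4 ^ ((1 : ℝ) / 4)
  have hA : 0 < A := by positivity
  have hP : ∀ q > 0, ∀ τ : ℝ, ‖∫ s in Ioi (0 : ℝ), besselProductKernel α q τ s‖ ≤ J :=
    fun q hq τ => norm_integral_le_of_norm_le
      (integrableOn_one_add_rpow_mul_rpow_neg_half.const_mul C)
      ((ae_restrict_mem measurableSet_Ioi).mono fun s hs => hk q hq τ s hs)
  have hbound : ∀ g : ℝ → ℝ, ∀ x > 0, ∀ τ : ℝ,
      ‖(∫ s in Ioi (0 : ℝ), besselProductKernel α (x / 4) τ s).re * g τ /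
        Real.cosh (Real.pi * τ)‖ ≤ J * (|g τ| / Real.cosh (Real.pi * τ)) := by
    intro g x hx τ
    rw [norm_div, norm_mul, Real.norm_of_nonneg (Real.cosh_pos _).le, mul_div_assoc,
      Real.norm_eq_abs (g τ)]
    have := Real.cosh_pos (Real.pi * τ)
    gcongr
    exact (Complex.abs_re_le_norm _).trans (hP _ (by positivity) τ)
  refine ⟨A * J + 1, by positivity, fun g hg hgi => ⟨?_, fun x hx => ?_⟩⟩
  · refine ContinuousOn.congr (f := fun x => A * ∫ τ : ℝ,
      (∫ s in Ioi (0 : ℝ), besselProductKernel α (x / 4) τ s).re * g τ /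
        Real.cosh (Real.pi * τ)) ?_ fun x hx => rpow_mul_Gtrans (by linarith) hx g
    refine continuousOn_const.mul (continuousOn_of_dominated (fun x hx => ?_)
      (fun x hx => ae_of_all _ (hbound g x hx)) (hgi.const_mul J) (ae_of_all _ fun τ => ?_))
    · have hc := continuous_integral_besselProductKernel (α := α) (q := x / 4) (by linarith)
        (div_pos hx four_pos)
      have hch : Continuous fun τ : ℝ => Real.cosh (Real.pi * τ) := by fun_prop
      exact (((Complex.continuous_re.comp hc).aestronglyMeasurable).mul hg).div₀
        hch.aestronglyMeasurable
    · have hc := (continuousOn_integral_besselProductKernel (α := α) (by linarith) τ).comp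
        (f := fun x : ℝ => x / 4) (s := Ioi 0) (by fun_prop) fun x hx => by
          have hx : 0 < x := hx
          exact div_pos hx four_pos
      exact ((Complex.continuous_re.comp_continuousOn hc).mul continuousOn_const).div_const _
  · have h0 : 0 ≤ ∫ τ : ℝ, |g τ| / Real.cosh (Real.pi * τ) :=
      integral_nonneg fun τ => div_nonneg (abs_nonneg _) (Real.cosh_pos _).le
    have hx4 : 0 ≤ x ^ ((1 : ℝ) / 4) := by positivity
    rw [← abs_of_nonneg hx4, ← abs_mul, rpow_mul_Gtrans (by linarith) hx, abs_mul,
      abs_of_pos hA]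
    calc _ ≤ A * ∫ τ : ℝ, J * (|g τ| / Real.cosh (Real.pi * τ)) := by
          gcongr
          exact norm_integral_le_of_norm_le (hgi.const_mul J) (ae_of_all _ (hbound g x hx))
      _ ≤ _ := by
          rw [integral_const_mul, add_mul, mul_assoc]
          linarith
end
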